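/- Let ρ be a quantum state on a finite-dimensional complex Hilbert space H, let {S_n}_{n≥1} satisfy Assumption 1, and suppose S_1 contains a state whose support contains supp(ρ). Let σ₀ be a minimizer of σ ↦ D(ρ‖σ) over S_1. Then min_{σ⁽ⁿ⁾ ∈ S_n} D(ρ^{⊗n} ‖ σ⁽ⁿ⁾) = n · min_{σ ∈ S_1} D(ρ‖σ) holds for all n ≥ 1 if and only if sup_{t ∈ ℝ, τ ∈ S_1} Tr[τ σ₀^{−(1+it)/2} ρ σ₀^{−(1−it)/2}] = 1. -/

import Mathlib

open scoped BigOperators ComplexOrder Classical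
open MeasureTheory Filter Set

noncomputable section

namespace QHT

variable {ι : Type*} [Fintype ι] [DecidableEq ι]

/-- Generalized matrix power `A ^ w` (complex exponent `w`) of a Hermitian matrix,
via functional calculus on the support: the eigenvalue `0` is mapped to `0`. -/
def mpow (A : Matrix ι ι ℂ) (w : ℂ) : Matrix ι ι ℂ :=
  if hA : A.IsHermitian then
    (hA.eigenvectorUnitary : Matrix ι ι ℂ) *
      Matrix.diagonal (fun i => if hA.eigenvalues i = 0 then 0 else (hA.eigenvalues i : ℂ) ^ w) *
      star (hA.eigenvectorUnitary : Matrix ι ι ℂ)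
  else 0

/-- Matrix logarithm of a Hermitian matrix, taken on its support
(`Real.log 0 = 0`, so the kernel is mapped to `0`). -/
def mlog (A : Matrix ι ι ℂ) : Matrix ι ι ℂ :=
  if hA : A.IsHermitian then
    (hA.eigenvectorUnitary : Matrix ι ι ℂ) *
      Matrix.diagonal (fun i => (Real.log (hA.eigenvalues i) : ℂ)) *
      star (hA.eigenvectorUnitary : Matrix ι ι ℂ)
  else 0

/-- The support of a matrix, i.e. its range as a linear map. -/
def msupp (A : Matrix ι ι ℂ) : Submodule ℂ (ι → ℂ) := LinearMap.range A.mulVecLin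

/-- A quantum state: a positive semidefinite matrix of trace one. -/
def IsState (A : Matrix ι ι ℂ) : Prop := A.PosSemidef ∧ A.trace = 1

/-- Real part of the trace. -/
def rtr (A : Matrix ι ι ℂ) : ℝ := A.trace.re

/-- The Umegaki relative entropy `D(ρ‖σ)`, with value `+∞` when `supp ρ ⊄ supp σ`. -/
def relEnt (ρ σ : Matrix ι ι ℂ) : EReal :=
  if msupp ρ ≤ msupp σ then ((rtr (ρ * (mlog ρ - mlog σ)) : ℝ) : EReal) else ⊤

/-- The polar of a set of matrices (intersected with the PSD cone). -/
def polar (S : Set (Matrix ι ι ℂ)) : Set (Matrix ι ι ℂ) :=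
  {X | X.PosSemidef ∧ ∀ Y ∈ S, rtr (X * Y) ≤ 1}

/-- Entrywise Bochner integral of a matrix-valued function over `ℝ`. -/
def mInt (f : ℝ → Matrix ι ι ℂ) : Matrix ι ι ℂ :=
  Matrix.of fun i j => ∫ t : ℝ, f t i j

/-- Entrywise Bochner integral of a matrix-valued function over a set `s ⊆ ℝ`. -/
def mIntOn (f : ℝ → Matrix ι ι ℂ) (s : Set ℝ) : Matrix ι ι ℂ :=
  Matrix.of fun i j => ∫ t in s, f t i j

/-- `sinc` function. -/
def sinc (s : ℝ) : ℝ := if s = 0 then 1 else Real.sin s / s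

/-- The probability density `β_θ` from the paper (`β₀` is the `θ → 0` limit). -/
def betaDist (θ t : ℝ) : ℝ :=
  if θ = 0 then Real.pi / (2 * (Real.cosh (Real.pi * t) + 1))
  else Real.sin (θ * Real.pi) / (2 * θ * (Real.cosh (Real.pi * t) + Real.cos (θ * Real.pi)))

/-- `Q_{α,z}(ρ‖σ) = Tr[(ρ^{α/2z} σ^{(1-α)/z} ρ^{α/2z})^z]`. -/
def Qaz (α z : ℝ) (ρ σ : Matrix ι ι ℂ) : ℝ :=
  rtr (mpow (mpow ρ ((α / (2 * z) : ℝ) : ℂ) * mpow σ (((1 - α) / z : ℝ) : ℂ) *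
      mpow ρ ((α / (2 * z) : ℝ) : ℂ)) ((z : ℝ) : ℂ))

/-- The `α`-`z` Rényi relative entropy. -/
def Daz (α z : ℝ) (ρ σ : Matrix ι ι ℂ) : EReal :=
  if (α < 1 ∧ (ρ * σ).trace ≠ 0) ∨ msupp ρ ≤ msupp σ then
    (((α - 1)⁻¹ * Real.log (Qaz α z ρ σ) : ℝ) : EReal)
  else ⊤

/-- `Q_α(ρ‖σ) = Tr[ρ^α σ^{1-α}]` (Petz). -/
def Qpetz (α : ℝ) (ρ σ : Matrix ι ι ℂ) : ℝ :=
  rtr (mpow ρ ((α : ℝ) : ℂ) * mpow σ (((1 - α) : ℝ) : ℂ))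

/-- The Petz Rényi divergence. -/
def Dpetz (α : ℝ) (ρ σ : Matrix ι ι ℂ) : EReal :=
  if (α < 1 ∧ (ρ * σ).trace ≠ 0) ∨ msupp ρ ≤ msupp σ then
    (((α - 1)⁻¹ * Real.log (Qpetz α ρ σ) : ℝ) : EReal)
  else ⊤

/-- `Q̃_α(ρ‖σ) = Tr[(σ^{(1-α)/2α} ρ σ^{(1-α)/2α})^α]` (sandwiched). -/
def Qsand (α : ℝ) (ρ σ : Matrix ι ι ℂ) : ℝ :=
  rtr (mpow (mpow σ (((1 - α) / (2 * α) : ℝ) : ℂ) * ρ * mpow σ (((1 - α) / (2 * α) : ℝ) : ℂ))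
    ((α : ℝ) : ℂ))

/-- The sandwiched Rényi divergence. -/
def Dsand (α : ℝ) (ρ σ : Matrix ι ι ℂ) : EReal :=
  if (α < 1 ∧ (ρ * σ).trace ≠ 0) ∨ msupp ρ ≤ msupp σ then
    (((α - 1)⁻¹ * Real.log (Qsand α ρ σ) : ℝ) : EReal)
  else ⊤

/-- `D̃_∞(ρ‖σ)`: the limit of `D̃_α(ρ‖σ)` as `α → +∞` (encoded as a `limsup`; the limit
exists by monotonicity in `α`). -/
def DsandInf (ρ σ : Matrix ι ι ℂ) : EReal :=
  Filter.limsup (fun α : ℝ => Dsand α ρ σ) Filter.atTop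

/-- `χ_{α,z}(ρ,σ) = ρ^{α/2z} (ρ^{α/2z} σ^{(1-α)/z} ρ^{α/2z})^{z-1} ρ^{α/2z}`. -/
def chi (α z : ℝ) (ρ σ : Matrix ι ι ℂ) : Matrix ι ι ℂ :=
  mpow ρ ((α / (2 * z) : ℝ) : ℂ) *
    mpow (mpow ρ ((α / (2 * z) : ℝ) : ℂ) * mpow σ (((1 - α) / z : ℝ) : ℂ) *
      mpow ρ ((α / (2 * z) : ℝ) : ℂ)) (((z - 1 : ℝ)) : ℂ) *
    mpow ρ ((α / (2 * z) : ℝ) : ℂ)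

/-- The data-processing region `𝒟` for `α`-`z` Rényi relative entropies. -/
def Dregion : Set (ℝ × ℝ) :=
  {p | (0 < p.1 ∧ p.1 < 1 ∧ max p.1 (1 - p.1) ≤ p.2) ∨
       (1 < p.1 ∧ max (p.1 / 2) (p.1 - 1) ≤ p.2 ∧ p.2 ≤ p.1) ∨
       (p.1 = 1 ∧ 0 < p.2)}

end QHT

namespace QHT

variable {ι : Type*} [Fintype ι] [DecidableEq ι]

/-! ### Tensor products and many copies -/

/-- Tensor product of a `d₁`- and a `d₂`-dimensional operator, as a `d₁d₂`-dimensional one. -/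
def dtens {a b : ℕ} (A : Matrix (Fin a) (Fin a) ℂ) (B : Matrix (Fin b) (Fin b) ℂ) :
    Matrix (Fin (a * b)) (Fin (a * b)) ℂ :=
  Matrix.of fun x y =>
    A (finProdFinEquiv.symm x).1 (finProdFinEquiv.symm y).1 *
      B (finProdFinEquiv.symm x).2 (finProdFinEquiv.symm y).2

/-- `ρ^{⊗n}` of a `d`-dimensional operator, as a `d^n`-dimensional operator. -/
def dpow {d : ℕ} (ρ : Matrix (Fin d) (Fin d) ℂ) (n : ℕ) :
    Matrix (Fin (d ^ n)) (Fin (d ^ n)) ℂ :=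
  Matrix.of fun x y => ∏ i, ρ (finFunctionFinEquiv.symm x i) (finFunctionFinEquiv.symm y i)

/-- The action of a permutation of the `k` tensor factors on an operator on `(ℂ^d)^{⊗k}`. -/
def permMat (d k : ℕ) (π : Equiv.Perm (Fin k)) (A : Matrix (Fin (d ^ k)) (Fin (d ^ k)) ℂ) :
    Matrix (Fin (d ^ k)) (Fin (d ^ k)) ℂ :=
  Matrix.of fun x y =>
    A (finFunctionFinEquiv ((finFunctionFinEquiv.symm x) ∘ π))
      (finFunctionFinEquiv ((finFunctionFinEquiv.symm y) ∘ π))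

/-- `ρ^{⊗n}` of a `d`-dimensional operator, as an operator on `H^{⊗n}` with `H = ℂ^d`,
indexed by tuples. -/
def tpow {d : ℕ} (ρ : Matrix (Fin d) (Fin d) ℂ) (n : ℕ) :
    Matrix (Fin n → Fin d) (Fin n → Fin d) ℂ :=
  Matrix.of fun x y => ∏ i, ρ (x i) (y i)

/-- Tensor product of an operator on `H^{⊗m}` and an operator on `H^{⊗n}`, as an
operator on `H^{⊗(m+n)}`. -/
def tensOp {d m n : ℕ} (A : Matrix (Fin m → Fin d) (Fin m → Fin d) ℂ)
    (B : Matrix (Fin n → Fin d) (Fin n → Fin d) ℂ) :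
    Matrix (Fin (m + n) → Fin d) (Fin (m + n) → Fin d) ℂ :=
  Matrix.of fun x y =>
    A (fun i => x (Fin.castAdd n i)) (fun i => y (Fin.castAdd n i)) *
      B (fun j => x (Fin.natAdd m j)) (fun j => y (Fin.natAdd m j))

/-- Permutation action on operators on `H^{⊗k}`. -/
def permOp {d k : ℕ} (π : Equiv.Perm (Fin k))
    (A : Matrix (Fin k → Fin d) (Fin k → Fin d) ℂ) :
    Matrix (Fin k → Fin d) (Fin k → Fin d) ℂ :=
  Matrix.of fun x y => A (x ∘ π) (y ∘ π)

/-! ### Hypothesis testing -/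

/-- A test: an operator `T` with `0 ≤ T ≤ I`. -/
def IsTest (T : Matrix ι ι ℂ) : Prop := T.PosSemidef ∧ (1 - T).PosSemidef

/-- Type I error `α_n(ρ|T) = Tr[(I - T) ρ^{⊗n}]`. -/
def typeI {d : ℕ} (ρ : Matrix (Fin d) (Fin d) ℂ) (n : ℕ)
    (T : Matrix (Fin n → Fin d) (Fin n → Fin d) ℂ) : ℝ :=
  rtr ((1 - T) * tpow ρ n)

/-- Type II error `β_n(S|T) = sup_{σ ∈ S} Tr[σ T]`. -/
def typeII {d n : ℕ} (S : Set (Matrix (Fin n → Fin d) (Fin n → Fin d) ℂ))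
    (T : Matrix (Fin n → Fin d) (Fin n → Fin d) ℂ) : ℝ :=
  sSup ((fun σ => rtr (σ * T)) '' S)

/-- `- log x`, valued in `EReal`, with `- log x = +∞` for `x ≤ 0`. -/
def negLog (x : ℝ) : EReal := if x ≤ 0 then ⊤ else ((- Real.log x : ℝ) : EReal)

/-- The exponential rate `-(1/n) log x`. -/
def rate (n : ℕ) (x : ℝ) : EReal := (((n : ℝ)⁻¹ : ℝ) : EReal) * negLog x

/-- The Stein exponent `s(ρ‖{S_n})`. -/
def steinExp {d : ℕ} (ρ : Matrix (Fin d) (Fin d) ℂ)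
    (S : (n : ℕ) → Set (Matrix (Fin n → Fin d) (Fin n → Fin d) ℂ)) : EReal :=
  sSup ((fun r : ℝ => (r : EReal)) ''
    {r : ℝ | 0 ≤ r ∧ ∃ T : (n : ℕ) → Matrix (Fin n → Fin d) (Fin n → Fin d) ℂ,
      (∀ n, IsTest (T n)) ∧
      (r : EReal) ≤ Filter.liminf (fun n => rate n (typeII (S n) (T n))) Filter.atTop ∧
      Filter.Tendsto (fun n => typeI ρ n (T n)) Filter.atTop (nhds 0)})

/-- The Chernoff exponent `c(ρ‖{S_n})`. -/
def chernoffExp {d : ℕ} (ρ : Matrix (Fin d) (Fin d) ℂ)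
    (S : (n : ℕ) → Set (Matrix (Fin n → Fin d) (Fin n → Fin d) ℂ)) : EReal :=
  Filter.liminf (fun n =>
    rate n (sInf ((fun T => typeI ρ n T + typeII (S n) T) '' {T | IsTest T}))) Filter.atTop

/-- The Hoeffding (direct) exponent `d_r(ρ‖{S_n})`. -/
def hoeffdingExp {d : ℕ} (r : ℝ) (ρ : Matrix (Fin d) (Fin d) ℂ)
    (S : (n : ℕ) → Set (Matrix (Fin n → Fin d) (Fin n → Fin d) ℂ)) : EReal :=
  ⨆ T : {T : (n : ℕ) → Matrix (Fin n → Fin d) (Fin n → Fin d) ℂ //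
      (∀ n, IsTest (T n)) ∧
      (r : EReal) ≤ Filter.liminf (fun n => rate n (typeII (S n) (T n))) Filter.atTop},
    Filter.liminf (fun n => rate n (typeI ρ n (T.1 n))) Filter.atTop

/-- The strong converse exponent `sc_r(ρ‖{S_n})`. -/
def scExp {d : ℕ} (r : ℝ) (ρ : Matrix (Fin d) (Fin d) ℂ)
    (S : (n : ℕ) → Set (Matrix (Fin n → Fin d) (Fin n → Fin d) ℂ)) : EReal :=
  ⨅ T : {T : (n : ℕ) → Matrix (Fin n → Fin d) (Fin n → Fin d) ℂ //
      (∀ n, IsTest (T n)) ∧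
      (r : EReal) ≤ Filter.liminf (fun n => rate n (typeII (S n) (T n))) Filter.atTop},
    Filter.limsup (fun n => rate n (1 - typeI ρ n (T.1 n))) Filter.atTop

/-- Assumption 1 of the paper for a family `{S_n}_{n ≥ 1}` of sets of operators
on `H^{⊗n}`, `H = ℂ^d`: each `S_n` is a convex compact set of positive semidefinite
operators, closed under tensor products, and with polar sets closed under tensor
products. -/
structure Assumption1 {d : ℕ}
    (S : (n : ℕ) → Set (Matrix (Fin n → Fin d) (Fin n → Fin d) ℂ)) : Prop where
  psd : ∀ n, 1 ≤ n → ∀ X ∈ S n, X.PosSemidef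
  convex : ∀ n, 1 ≤ n → Convex ℝ (S n)
  compact : ∀ n, 1 ≤ n → IsCompact (S n)
  tens : ∀ m n, 1 ≤ m → 1 ≤ n → ∀ A ∈ S m, ∀ B ∈ S n, tensOp A B ∈ S (m + n)
  polarTens : ∀ m n, 1 ≤ m → 1 ≤ n →
    ∀ A ∈ polar (S m), ∀ B ∈ polar (S n), tensOp A B ∈ polar (S (m + n))

/-- Assumption 1′ of the paper for a dimension-indexed family `{S_d}_{d ≥ 1}`. -/
structure Assumption1' (S : (d : ℕ) → Set (Matrix (Fin d) (Fin d) ℂ)) : Prop where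
  psd : ∀ d, 1 ≤ d → ∀ X ∈ S d, X.PosSemidef
  convex : ∀ d, 1 ≤ d → Convex ℝ (S d)
  compact : ∀ d, 1 ≤ d → IsCompact (S d)
  tens : ∀ d₁ d₂, 1 ≤ d₁ → 1 ≤ d₂ → ∀ A ∈ S d₁, ∀ B ∈ S d₂, dtens A B ∈ S (d₁ * d₂)
  polarTens : ∀ d₁ d₂, 1 ≤ d₁ → 1 ≤ d₂ →
    ∀ A ∈ polar (S d₁), ∀ B ∈ polar (S d₂), dtens A B ∈ polar (S (d₁ * d₂))

end QHT

namespace QHT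

/-! ### Scalar integrals -/

lemma integrableOn_resolvent_mul_and_integral {a b : ℝ} (ha : 0 < a) (hb : 0 < b) :
    IntegrableOn (fun s : ℝ => (a + s)⁻¹ * (b + s)⁻¹) (Ioi 0) ∧
      ∫ s in Ioi (0 : ℝ), (a + s)⁻¹ * (b + s)⁻¹ =
        if a = b then a⁻¹ else (Real.log a - Real.log b) / (a - b) := by
  have hpos : ∀ x ∈ Ioi (0 : ℝ), 0 ≤ (a + x)⁻¹ * (b + x)⁻¹ := by
    intro x hx
    have hx : 0 < x := hx
    positivity
  obtain ⟨g, l, hg, hl, hval⟩ : ∃ (g : ℝ → ℝ) (l : ℝ),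
      (∀ x ∈ Ici (0 : ℝ), HasDerivAt g ((a + x)⁻¹ * (b + x)⁻¹) x) ∧
      Tendsto g atTop (nhds l) ∧
      l - g 0 = if a = b then a⁻¹ else (Real.log a - Real.log b) / (a - b) := by
    by_cases hab : a = b
    · subst hab
      refine ⟨fun x => -(a + x)⁻¹, -0, ?_, ?_, by simp⟩
      · intro x hx
        have hx : 0 ≤ x := hx
        have h0 : a + x ≠ 0 := by positivity
        have h := (((hasDerivAt_id x).const_add a).inv h0).neg
        convert! h using 1
        simp only [id]
        field_simp
      · exact (tendsto_inv_atTop_zero.comp (tendsto_atTop_add_const_left _ a tendsto_id)).neg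
    · have hba : b - a ≠ 0 := sub_ne_zero.2 (Ne.symm hab)
      have hba' : a - b ≠ 0 := sub_ne_zero.2 hab
      refine ⟨fun x => (Real.log (a + x) - Real.log (b + x)) / (b - a), 0 / (b - a), ?_, ?_, ?_⟩
      · intro x hx
        have hx : 0 ≤ x := hx
        have h0 : a + x ≠ 0 := by positivity
        have h1 : b + x ≠ 0 := by positivity
        have h := ((((hasDerivAt_id x).const_add a).log h0).sub
          (((hasDerivAt_id x).const_add b).log h1)).div_const (b - a)
        convert! h using 1
        simp only [id]
        field_simp
        ring
      · refine Tendsto.div_const ?_ _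
        have h1 : Tendsto (fun x : ℝ => 1 + (a - b) * (b + x)⁻¹) atTop (nhds (1 + (a - b) * 0)) :=
          ((tendsto_inv_atTop_zero.comp
            (tendsto_atTop_add_const_left _ b tendsto_id)).const_mul _).const_add _
        have h2 := h1.log (by norm_num)
        simp only [mul_zero, add_zero, Real.log_one] at h2
        refine h2.congr' ?_
        filter_upwards [eventually_gt_atTop 0] with x hx
        rw [← Real.log_div (by positivity) (by positivity)]
        congr 1
        field_simp
        ring
      · simp only [hab, if_false, add_zero]
        field_simp
        ring
  exact ⟨integrableOn_Ioi_deriv_of_nonneg' hg hpos hl,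
    (integral_Ioi_of_hasDerivAt_of_nonneg' hg hpos hl).trans hval⟩

lemma integrableOn_log_kernel_and_integral {a : ℝ} (ha : 0 < a) :
    IntegrableOn (fun s : ℝ => (1 + s)⁻¹ - (a + s)⁻¹) (Ioi 0) ∧
      ∫ s in Ioi (0 : ℝ), ((1 + s)⁻¹ - (a + s)⁻¹) = Real.log a := by
  obtain ⟨h1, h2⟩ := integrableOn_resolvent_mul_and_integral one_pos ha
  have heq : EqOn (fun s : ℝ => (a - 1) * ((1 + s)⁻¹ * (a + s)⁻¹))
      (fun s : ℝ => (1 + s)⁻¹ - (a + s)⁻¹) (Ioi 0) := by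
    intro s hs
    have hs : 0 < s := hs
    have : a + s ≠ 0 := by positivity
    simp only
    field_simp
    ring
  refine ⟨IntegrableOn.congr_fun (h1.const_mul (a - 1)) heq measurableSet_Ioi, ?_⟩
  rw [← setIntegral_congr_fun measurableSet_Ioi heq, integral_const_mul, h2]
  split_ifs with h
  · simp [← h]
  · have : (1 : ℝ) - a ≠ 0 := sub_ne_zero.2 h
    rw [Real.log_one]
    field_simp
    ring

/-- The quantile function of the logistic distribution with scale `1 / π`. -/
def logisticQuantile (p : ℝ) : ℝ := Real.log (p / (1 - p)) / Real.pi

lemma continuousOn_logisticQuantile : ContinuousOn logisticQuantile (Ioo 0 1) := by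
  unfold logisticQuantile
  refine ContinuousOn.div_const (ContinuousOn.log ?_ ?_) _
  · refine continuousOn_id.div (by fun_prop) ?_
    intro x hx
    have := hx.2
    simp only [ne_eq]
    linarith
  · intro x hx
    have := hx.1
    have h2 : 0 < 1 - x := by linarith [hx.2]
    positivity

lemma exists_logisticQuantile_eq (t : ℝ) : ∃ p ∈ Ioo (0 : ℝ) 1, logisticQuantile p = t := by
  have he := Real.exp_pos (Real.pi * t)
  refine ⟨Real.exp (Real.pi * t) / (1 + Real.exp (Real.pi * t)),
    ⟨by positivity, (div_lt_one (by positivity)).2 (by linarith)⟩, ?_⟩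
  have : Real.exp (Real.pi * t) / (1 + Real.exp (Real.pi * t)) /
      (1 - Real.exp (Real.pi * t) / (1 + Real.exp (Real.pi * t))) = Real.exp (Real.pi * t) := by
    have h1 : 1 + Real.exp (Real.pi * t) ≠ 0 := by positivity
    field_simp
    ring
  rw [logisticQuantile, this, Real.log_exp]
  field_simp

lemma betaIntegral_one_sub_one_add (y : ℝ) :
    Complex.betaIntegral (1 - y * Complex.I) (1 + y * Complex.I) =
      if y = 0 then 1 else ((Real.pi * y / Real.sinh (Real.pi * y) : ℝ) : ℂ) := by
  have h := Complex.Gamma_mul_Gamma_eq_betaIntegral (s := 1 - y * Complex.I)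
    (t := 1 + y * Complex.I) (by simp) (by simp)
  have h2 : Complex.Gamma (1 - y * Complex.I + (1 + y * Complex.I)) = 1 := by
    have : (1 - y * Complex.I + (1 + y * Complex.I) : ℂ) = 1 + 1 := by ring
    rw [this, Complex.Gamma_add_one _ one_ne_zero, Complex.Gamma_one, one_mul]
  rw [h2, one_mul] at h
  rw [← h]
  split_ifs with hy
  · simp [hy]
  · have hyI : (y : ℂ) * Complex.I ≠ 0 := by simp [hy]
    have hs : (Real.sinh (Real.pi * y) : ℂ) ≠ 0 := by
      rw [Complex.ofReal_ne_zero, Real.sinh_ne_zero]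
      positivity
    have hsin : Complex.sin (Real.pi * (y * Complex.I)) =
        (Real.sinh (Real.pi * y) : ℂ) * Complex.I := by
      rw [← mul_assoc, ← Complex.ofReal_mul, Complex.sin_mul_I, Complex.ofReal_sinh]
    rw [add_comm 1 ((y : ℂ) * Complex.I), Complex.Gamma_add_one _ hyI, mul_left_comm,
      mul_comm (Complex.Gamma (1 - _)), Complex.Gamma_mul_Gamma_one_sub, hsin,
      Complex.ofReal_div, Complex.ofReal_mul]
    field_simp

lemma integrableOn_and_integral_cpow_mul_cpow {a b : ℝ} (ha : 0 < a) (hb : 0 < b) :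
    IntegrableOn (fun p : ℝ =>
      (a : ℂ) ^ (-((1 : ℂ) + Complex.I * (logisticQuantile p : ℂ)) / 2) *
      (b : ℂ) ^ (-((1 : ℂ) - Complex.I * (logisticQuantile p : ℂ)) / 2)) (Ioo 0 1) ∧
    ∫ p in Ioo (0 : ℝ) 1,
      (a : ℂ) ^ (-((1 : ℂ) + Complex.I * (logisticQuantile p : ℂ)) / 2) *
      (b : ℂ) ^ (-((1 : ℂ) - Complex.I * (logisticQuantile p : ℂ)) / 2) =
    ((∫ s in Ioi (0 : ℝ), (a + s)⁻¹ * (b + s)⁻¹ : ℝ) : ℂ) := by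
  set y : ℝ := (Real.log a - Real.log b) / (2 * Real.pi) with hy
  set c : ℝ := Real.exp (-(Real.log a + Real.log b) / 2) with hc
  have heq : EqOn (fun p : ℝ => (c : ℂ) * ((p : ℂ) ^ ((1 - y * Complex.I : ℂ) - 1) *
        (1 - (p : ℂ)) ^ ((1 + y * Complex.I : ℂ) - 1)))
      (fun p : ℝ => (a : ℂ) ^ (-((1 : ℂ) + Complex.I * (logisticQuantile p : ℂ)) / 2) *
        (b : ℂ) ^ (-((1 : ℂ) - Complex.I * (logisticQuantile p : ℂ)) / 2)) (Ioo 0 1) := by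
    intro p hp
    have hp0 : 0 < p := hp.1
    have hp1 : 0 < 1 - p := by linarith [hp.2]
    have e1 : (1 - (p : ℂ)) = ((1 - p : ℝ) : ℂ) := by push_cast; rfl
    simp only
    rw [e1, Complex.cpow_def_of_ne_zero (x := (a : ℂ)) (by exact_mod_cast ha.ne'),
      Complex.cpow_def_of_ne_zero (x := (b : ℂ)) (by exact_mod_cast hb.ne'),
      Complex.cpow_def_of_ne_zero (x := (p : ℂ)) (by exact_mod_cast hp0.ne'),
      Complex.cpow_def_of_ne_zero (x := ((1 - p : ℝ) : ℂ)) (by exact_mod_cast hp1.ne'),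
      ← Complex.ofReal_log ha.le, ← Complex.ofReal_log hb.le, ← Complex.ofReal_log hp0.le,
      ← Complex.ofReal_log hp1.le, hc, Complex.ofReal_exp, ← Complex.exp_add, ← Complex.exp_add,
      ← Complex.exp_add, logisticQuantile, Real.log_div hp0.ne' hp1.ne', hy]
    congr 1
    have hpi : (Real.pi : ℂ) ≠ 0 := by exact_mod_cast Real.pi_ne_zero
    push_cast
    field_simp
    ring
  have hconv := Complex.betaIntegral_convergent (u := 1 - y * Complex.I) (v := 1 + y * Complex.I)
    (by simp) (by simp)
  rw [intervalIntegrable_iff_integrableOn_Ioo_of_le zero_le_one] at hconv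
  refine ⟨IntegrableOn.congr_fun (hconv.const_mul (c : ℂ)) heq measurableSet_Ioo, ?_⟩
  rw [← setIntegral_congr_fun measurableSet_Ioo heq, integral_const_mul,
    ← integral_Ioc_eq_integral_Ioo, ← intervalIntegral.integral_of_le zero_le_one]
  change (c : ℂ) * Complex.betaIntegral _ _ = _
  rw [betaIntegral_one_sub_one_add, (integrableOn_resolvent_mul_and_integral ha hb).2]
  have hy0 : y = 0 ↔ a = b := by
    rw [hy, div_eq_zero_iff, or_iff_left (by positivity), sub_eq_zero]
    exact ⟨fun h => Real.log_injOn_pos ha hb h, fun h => by rw [h]⟩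
  by_cases hab : a = b
  · rw [if_pos (hy0.2 hab), if_pos hab, mul_one, hc, ← hab]
    congr 1
    rw [show -(Real.log a + Real.log a) / 2 = -Real.log a by ring, Real.exp_neg, Real.exp_log ha]
  · rw [if_neg (fun h => hab (hy0.1 h)), if_neg hab, ← Complex.ofReal_mul]
    congr 1
    have hab' : a - b ≠ 0 := sub_ne_zero.2 hab
    have e1 : Real.pi * y = (Real.log a - Real.log b) / 2 := by
      rw [hy]
      field_simp
    have e2 : a - b = 2 * Real.exp ((Real.log a + Real.log b) / 2) *
        Real.sinh ((Real.log a - Real.log b) / 2) := by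
      rw [Real.sinh_eq]
      have h1 : Real.exp ((Real.log a + Real.log b) / 2) *
          Real.exp ((Real.log a - Real.log b) / 2) = a := by
        rw [← Real.exp_add]
        ring_nf
        exact Real.exp_log ha
      have h2 : Real.exp ((Real.log a + Real.log b) / 2) *
          Real.exp (-((Real.log a - Real.log b) / 2)) = b := by
        rw [← Real.exp_add]
        ring_nf
        exact Real.exp_log hb
      linear_combination -h1 + h2
    have hsinh : Real.sinh ((Real.log a - Real.log b) / 2) ≠ 0 := by
      intro h0
      rw [h0, mul_zero] at e2
      exact hab' e2
    rw [e1, hc, e2, neg_div, Real.exp_neg]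
    have := (Real.exp_pos ((Real.log a + Real.log b) / 2)).ne'
    field_simp

/-! ### Diagonalizations and functional calculus -/

section Diagonalization

variable {ι : Type*} [Fintype ι] [DecidableEq ι]

/-- `A = U diag(a) U*` with `U` unitary and `a` real. -/
structure Diagonalizes (A U : Matrix ι ι ℂ) (a : ι → ℝ) : Prop where
  star_mul : star U * U = 1
  mul_star : U * star U = 1
  eq : A = U * Matrix.diagonal (fun i => (a i : ℂ)) * star U

lemma diagonalizes_eigenvectorUnitary {A : Matrix ι ι ℂ} (hA : A.IsHermitian) :
    Diagonalizes A (hA.eigenvectorUnitary : Matrix ι ι ℂ) hA.eigenvalues := by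
  refine ⟨by simp, by simp, ?_⟩
  conv_lhs => rw [hA.spectral_theorem]
  rw [Unitary.conjStarAlgAut_apply]
  rfl

lemma exists_diagonalizes {A : Matrix ι ι ℂ} (hA : A.PosSemidef) :
    ∃ (U : Matrix ι ι ℂ) (a : ι → ℝ), Diagonalizes A U a ∧ ∀ i, 0 ≤ a i :=
  ⟨_, _, diagonalizes_eigenvectorUnitary hA.1, hA.eigenvalues_nonneg⟩

namespace Diagonalizes

variable {A U V : Matrix ι ι ℂ} {a b : ι → ℝ}

lemma isHermitian (h : Diagonalizes A U a) : A.IsHermitian := by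
  rw [h.eq, Matrix.star_eq_conjTranspose]
  refine Matrix.isHermitian_mul_mul_conjTranspose U ?_
  rw [Matrix.IsHermitian, Matrix.diagonal_conjTranspose]
  congr 1
  ext i
  simp

/-- The functional calculus does not depend on the diagonalization. -/
lemma conj_diagonal_eq (hU : Diagonalizes A U a) (hV : Diagonalizes A V b) (f : ℝ → ℂ) :
    U * Matrix.diagonal (fun i => f (a i)) * star U =
      V * Matrix.diagonal (fun i => f (b i)) * star V := by
  set W := star V * U with hW
  have h1 : Matrix.diagonal (fun i => (b i : ℂ)) * W =
      W * Matrix.diagonal (fun i => (a i : ℂ)) := by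
    have e1 : star V * A * U = Matrix.diagonal (fun i => (b i : ℂ)) * W := by
      rw [hV.eq, hW]
      simp only [← mul_assoc, hV.star_mul, one_mul]
    have e2 : star V * A * U = W * Matrix.diagonal (fun i => (a i : ℂ)) := by
      rw [hU.eq, hW]
      simp only [mul_assoc, hU.star_mul, mul_one]
    rw [← e1, e2]
  have h2 : Matrix.diagonal (fun i => f (b i)) * W = W * Matrix.diagonal (fun i => f (a i)) := by
    ext i j
    have := congr_fun (congr_fun h1 i) j
    rw [Matrix.diagonal_mul, Matrix.mul_diagonal] at this ⊢
    by_cases hw : W i j = 0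
    · simp [hw]
    · rw [mul_comm] at this
      have := mul_left_cancel₀ hw this
      rw [Complex.ofReal_inj.1 this, mul_comm]
  calc U * Matrix.diagonal (fun i => f (a i)) * star U
      = V * (W * Matrix.diagonal (fun i => f (a i))) * star U := by
        rw [hW]
        simp only [← mul_assoc, hV.mul_star, one_mul]
    _ = V * Matrix.diagonal (fun i => f (b i)) * star V := by
        rw [← h2, hW]
        simp only [mul_assoc, hU.mul_star, mul_one]

lemma mpow_eq (h : Diagonalizes A U a) (w : ℂ) :
    mpow A w = U * Matrix.diagonal (fun i => if a i = 0 then 0 else (a i : ℂ) ^ w) * star U := by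
  rw [mpow, dif_pos h.isHermitian]
  exact conj_diagonal_eq (diagonalizes_eigenvectorUnitary h.isHermitian) h
    (fun x => if x = 0 then 0 else (x : ℂ) ^ w)

lemma mlog_eq (h : Diagonalizes A U a) :
    mlog A = U * Matrix.diagonal (fun i => (Real.log (a i) : ℂ)) * star U := by
  rw [mlog, dif_pos h.isHermitian]
  exact conj_diagonal_eq (diagonalizes_eigenvectorUnitary h.isHermitian) h
    (fun x => (Real.log x : ℂ))

lemma conj_diagonal_mul (h : Diagonalizes A U a) (f g : ι → ℂ) :
    U * Matrix.diagonal f * star U * (U * Matrix.diagonal g * star U) =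
      U * Matrix.diagonal (fun i => f i * g i) * star U := by
  rw [← Matrix.diagonal_mul_diagonal]
  simp only [mul_assoc]
  rw [← mul_assoc (star U) U, h.star_mul, one_mul]

lemma add_smul_one (h : Diagonalizes A U a) (s : ℝ) :
    A + (s : ℂ) • 1 = U * Matrix.diagonal (fun i => ((a i + s : ℝ) : ℂ)) * star U := by
  have h1 : Matrix.diagonal (fun i => ((a i + s : ℝ) : ℂ)) =
      Matrix.diagonal (fun i => (a i : ℂ)) + (s : ℂ) • (1 : Matrix ι ι ℂ) := by
    ext i j
    by_cases hij : i = j <;> simp [hij]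
  rw [h1, mul_add, add_mul, ← h.eq]
  simp [h.mul_star]

lemma isUnit_add_smul_one_and_inv (h : Diagonalizes A U a) (ha : ∀ i, 0 ≤ a i) {s : ℝ}
    (hs : 0 < s) : IsUnit (A + (s : ℂ) • 1) ∧
    (A + (s : ℂ) • 1)⁻¹ = U * Matrix.diagonal (fun i => (((a i + s)⁻¹ : ℝ) : ℂ)) * star U := by
  have h1 : (A + (s : ℂ) • 1) *
      (U * Matrix.diagonal (fun i => (((a i + s)⁻¹ : ℝ) : ℂ)) * star U) = 1 := by
    rw [h.add_smul_one, h.conj_diagonal_mul]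
    have : (fun i => ((a i + s : ℝ) : ℂ) * (((a i + s)⁻¹ : ℝ) : ℂ)) = fun _ => 1 := by
      ext i
      have : a i + s ≠ 0 := (add_pos_of_nonneg_of_pos (ha i) hs).ne'
      rw [← Complex.ofReal_mul, mul_inv_cancel₀ this, Complex.ofReal_one]
    rw [this, Matrix.diagonal_one, mul_one, h.mul_star]
  exact ⟨IsUnit.of_mul_eq_one _ h1, Matrix.inv_eq_right_inv h1⟩

lemma trace_mul_conj_diagonal (B : Matrix ι ι ℂ) (U : Matrix ι ι ℂ) (f : ι → ℂ) :
    (B * (U * Matrix.diagonal f * star U)).trace = ∑ i, (star U * B * U) i i * f i := by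
  have h1 : B * (U * Matrix.diagonal f * star U) = B * U * Matrix.diagonal f * star U := by
    simp only [mul_assoc]
  rw [h1, Matrix.trace_mul_comm, ← mul_assoc, ← mul_assoc]
  simp [Matrix.trace, Matrix.mul_diagonal]

lemma trace_mul_conj_diagonal_mul_mul (T B U : Matrix ι ι ℂ) (f g : ι → ℂ) :
    (T * (U * Matrix.diagonal f * star U * B * (U * Matrix.diagonal g * star U))).trace =
      ∑ i, ∑ j, (star U * T * U) j i * (star U * B * U) i j * (f i * g j) := by
  have h1 : (T * (U * Matrix.diagonal f * star U * B * (U * Matrix.diagonal g * star U))).trace =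
      ((Matrix.diagonal f * (star U * B * U)) * (Matrix.diagonal g * (star U * T * U))).trace := by
    have : T * (U * Matrix.diagonal f * star U * B * (U * Matrix.diagonal g * star U)) =
        (T * U) * (Matrix.diagonal f * (star U * B * U) * (Matrix.diagonal g * star U)) := by
      simp only [mul_assoc]
    rw [this, Matrix.trace_mul_comm]
    simp only [mul_assoc]
  rw [h1]
  simp only [Matrix.trace, Matrix.diag, Matrix.mul_apply (M := Matrix.diagonal f * _),
    Matrix.diagonal_mul]
  refine Finset.sum_congr rfl fun i _ => Finset.sum_congr rfl fun j _ => ?_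
  ring

lemma trace_eq_sum (h : Diagonalizes A U a) (B : Matrix ι ι ℂ) :
    B.trace = ∑ i, (star U * B * U) i i := by
  have := trace_mul_conj_diagonal B U (fun _ => 1)
  rw [Matrix.diagonal_one, mul_one, h.mul_star, mul_one] at this
  simpa using this

lemma mpow_zero_mul_self (h : Diagonalizes A U a) : mpow A 0 * A = A := by
  conv_rhs => rw [h.eq]
  rw [h.mpow_eq]
  conv_lhs => rw [h.eq]
  rw [h.conj_diagonal_mul]
  congr 3
  ext i
  by_cases hi : a i = 0 <;> simp [hi]

lemma mul_mpow_neg_one (h : Diagonalizes A U a) : A * mpow A (-1) = mpow A 0 := by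
  rw [h.mpow_eq, h.mpow_eq]
  conv_lhs => rw [h.eq]
  rw [h.conj_diagonal_mul]
  congr 3
  ext i
  by_cases hi : a i = 0 <;> simp [hi, Complex.cpow_neg_one]

end Diagonalizes

lemma rtr_add {κ : Type*} [Fintype κ] (A B : Matrix κ κ ℂ) :
    rtr (A + B) = rtr A + rtr B := by simp [rtr]

lemma rtr_sub {κ : Type*} [Fintype κ] (A B : Matrix κ κ ℂ) :
    rtr (A - B) = rtr A - rtr B := by simp [rtr]

lemma rtr_smul {κ : Type*} [Fintype κ] (r : ℝ) (A : Matrix κ κ ℂ) : rtr (r • A) = r * rtr A := by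
  simp [rtr, Matrix.trace_smul]

lemma trace_mul_nonneg {A B : Matrix ι ι ℂ} (hA : A.PosSemidef) (hB : B.PosSemidef) :
    0 ≤ (A * B).trace := by
  obtain ⟨U, b, h, hb⟩ := exists_diagonalizes hB
  rw [h.eq, Diagonalizes.trace_mul_conj_diagonal]
  refine Finset.sum_nonneg fun i _ => mul_nonneg ?_ (by exact_mod_cast hb i)
  exact (hA.conjTranspose_mul_mul_same U).diag_nonneg

lemma rtr_mul_nonneg {A B : Matrix ι ι ℂ} (hA : A.PosSemidef) (hB : B.PosSemidef) :
    0 ≤ rtr (A * B) :=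
  (Complex.le_def.1 (trace_mul_nonneg hA hB)).1

/-! ### Supports -/

lemma msupp_le_iff_mpow_zero_mul {ρ σ : Matrix ι ι ℂ} (hσ : σ.PosSemidef) :
    msupp ρ ≤ msupp σ ↔ mpow σ 0 * ρ = ρ := by
  obtain ⟨U, s, h, -⟩ := exists_diagonalizes hσ
  constructor
  · intro hle
    refine Matrix.ext_of_mulVec_single fun i => ?_
    obtain ⟨u, hu⟩ := hle (LinearMap.mem_range_self ρ.mulVecLin (Pi.single i 1))
    simp only [Matrix.mulVecLin_apply] at hu
    rw [← Matrix.mulVec_mulVec, ← hu, Matrix.mulVec_mulVec, h.mpow_zero_mul_self]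
  · rintro he _ ⟨v, rfl⟩
    refine ⟨(mpow σ (-1) * ρ).mulVec v, ?_⟩
    rw [Matrix.mulVecLin_apply, Matrix.mulVecLin_apply, Matrix.mulVec_mulVec, ← mul_assoc,
      h.mul_mpow_neg_one, he]

lemma Diagonalizes.coeff_eq_zero {ρ σ U : Matrix ι ι ℂ} {s : ι → ℝ} (h : Diagonalizes σ U s)
    (hσ : σ.PosSemidef) (hρ : ρ.IsHermitian) (hle : msupp ρ ≤ msupp σ) (i j : ι)
    (hij : s i = 0 ∨ s j = 0) : (star U * ρ * U) i j = 0 := by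
  have key : ∀ i j, s i = 0 → (star U * ρ * U) i j = 0 := by
    intro i j hi
    rw [msupp_le_iff_mpow_zero_mul hσ] at hle
    rw [← hle, h.mpow_eq]
    have : star U * (U * Matrix.diagonal (fun i => if s i = 0 then 0 else (s i : ℂ) ^ (0 : ℂ)) *
        star U * ρ) * U = Matrix.diagonal (fun i => if s i = 0 then 0 else (s i : ℂ) ^ (0 : ℂ)) *
        (star U * ρ * U) := by
      simp only [← mul_assoc, h.star_mul, one_mul]
    rw [this, Matrix.diagonal_mul, if_pos hi, zero_mul]
  rcases hij with hi | hj
  · exact key i j hi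
  · have hH : (star U * ρ * U).IsHermitian := by
      rw [Matrix.star_eq_conjTranspose]
      exact Matrix.isHermitian_conjTranspose_mul_mul U hρ
    rw [← hH.apply, key j i hj, star_zero]

lemma msupp_le_of_mulVec_eq_zero {ρ σ : Matrix ι ι ℂ} (hσ : σ.PosSemidef) (hρ : ρ.IsHermitian)
    (hker : ∀ v, σ.mulVec v = 0 → ρ.mulVec v = 0) : msupp ρ ≤ msupp σ := by
  obtain ⟨U, s, h, -⟩ := exists_diagonalizes hσ
  have hPH : (mpow σ 0).IsHermitian := by
    rw [h.mpow_eq, Matrix.star_eq_conjTranspose]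
    refine Matrix.isHermitian_mul_mul_conjTranspose U ?_
    rw [Matrix.IsHermitian, Matrix.diagonal_conjTranspose]
    congr 1
    ext i
    by_cases hi : s i = 0 <;> simp [hi]
  have h1 : σ * (1 - mpow σ 0) = 0 := by
    have := congr_arg Matrix.conjTranspose h.mpow_zero_mul_self
    rw [Matrix.conjTranspose_mul, hPH.eq, hσ.1.eq] at this
    rw [mul_sub, mul_one, this, sub_self]
  have h2 : ρ * (1 - mpow σ 0) = 0 := by
    refine Matrix.ext_of_mulVec_single fun i => ?_
    rw [← Matrix.mulVec_mulVec, hker _ (by rw [Matrix.mulVec_mulVec, h1, Matrix.zero_mulVec]),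
      Matrix.zero_mulVec]
  have h3 := congr_arg Matrix.conjTranspose h2
  rw [Matrix.conjTranspose_mul, hρ.eq, Matrix.conjTranspose_sub, hPH.eq, Matrix.conjTranspose_one,
    Matrix.conjTranspose_zero, sub_mul, one_mul, sub_eq_zero] at h3
  exact (msupp_le_iff_mpow_zero_mul hσ).2 h3.symm

lemma msupp_le_add {ρ σ τ : Matrix ι ι ℂ} (hρ : ρ.IsHermitian) (hσ : σ.PosSemidef)
    (hτ : τ.PosSemidef) (hle : msupp ρ ≤ msupp σ) {x y : ℝ} (hx : 0 < x) (hy : 0 ≤ y) :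
    msupp ρ ≤ msupp (x • σ + y • τ) := by
  have hxσ : (x • σ).PosSemidef := hσ.smul hx.le
  have hyτ : (y • τ).PosSemidef := hτ.smul hy
  refine msupp_le_of_mulVec_eq_zero (hxσ.add hyτ) hρ fun v hv => ?_
  have h0 := congr_arg (fun u => star v ⬝ᵥ u) hv
  simp only [Matrix.add_mulVec, dotProduct_add, dotProduct_zero] at h0
  have h1 := (add_eq_zero_iff_of_nonneg (hxσ.dotProduct_mulVec_nonneg v)
    (hyτ.dotProduct_mulVec_nonneg v)).1 h0
  have h2 := (hxσ.dotProduct_mulVec_zero_iff v).1 h1.1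
  have h3 : σ.mulVec v = 0 := by
    rw [Matrix.smul_mulVec] at h2
    exact (smul_eq_zero.1 h2).resolve_left hx.ne'
  have h4 := (msupp_le_iff_mpow_zero_mul hσ).1 hle
  obtain ⟨U, s, h, -⟩ := exists_diagonalizes hσ
  rw [← h.mul_mpow_neg_one, mul_assoc] at h4
  have h5 := congr_arg Matrix.conjTranspose h4
  rw [Matrix.conjTranspose_mul, hσ.1.eq, hρ.eq] at h5
  rw [← h5, ← Matrix.mulVec_mulVec, h3, Matrix.mulVec_zero]

end Diagonalization

/-! ### Integral representations of the logarithm and of its derivative -/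

section Integrals

variable {ι : Type*} [Fintype ι] [DecidableEq ι]

/-- The shifted inverse `(σ + s)⁻¹`. -/
def shiftInv (σ : Matrix ι ι ℂ) (s : ℝ) : Matrix ι ι ℂ := (σ + (s : ℂ) • 1)⁻¹

/-- The operator `σ^{-(1+it)/2} ρ σ^{-(1-it)/2}`. -/
def rotated (σ ρ : Matrix ι ι ℂ) (t : ℝ) : Matrix ι ι ℂ :=
  mpow σ (-((1 : ℂ) + Complex.I * (t : ℂ)) / 2) * ρ *
    mpow σ (-((1 : ℂ) - Complex.I * (t : ℂ)) / 2)

/-- The integrand in the integral representation of the derivative of `Tr[ρ log σ]` in the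
direction `τ`. -/
def logDerivKernel (τ σ ρ : Matrix ι ι ℂ) (s : ℝ) : ℝ :=
  rtr (τ * (shiftInv σ s * ρ * shiftInv σ s))

variable {ρ σ τ : Matrix ι ι ℂ}

lemma star_ofReal_cpow {a : ℝ} (ha : 0 < a) (w : ℂ) :
    star ((a : ℂ) ^ w) = (a : ℂ) ^ (star w) := by
  have h := Complex.cpow_conj (a : ℂ) w
    (by rw [Complex.arg_ofReal_of_nonneg ha.le]; exact Real.pi_pos.ne)
  rw [Complex.conj_ofReal] at h
  exact h.symm

lemma conjTranspose_mpow (hσ : σ.PosSemidef) (w : ℂ) :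
    (mpow σ w).conjTranspose = mpow σ (star w) := by
  obtain ⟨U, s, h, hs⟩ := exists_diagonalizes hσ
  rw [h.mpow_eq, h.mpow_eq, Matrix.conjTranspose_mul, Matrix.conjTranspose_mul,
    Matrix.star_eq_conjTranspose, Matrix.conjTranspose_conjTranspose,
    Matrix.diagonal_conjTranspose, mul_assoc]
  congr 3
  ext i
  rw [Pi.star_apply]
  split_ifs with hi
  · simp
  · exact star_ofReal_cpow ((hs i).lt_of_ne' hi) w

lemma posSemidef_rotated (hσ : σ.PosSemidef) (hρ : ρ.PosSemidef) (t : ℝ) :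
    (rotated σ ρ t).PosSemidef := by
  have : mpow σ (-((1 : ℂ) - Complex.I * (t : ℂ)) / 2) =
      (mpow σ (-((1 : ℂ) + Complex.I * (t : ℂ)) / 2)).conjTranspose := by
    rw [conjTranspose_mpow hσ]
    congr 1
    simp [sub_eq_add_neg]
  rw [rotated, this]
  exact hρ.mul_mul_conjTranspose_same _

lemma rtr_self_mul_rotated (hσ : σ.PosSemidef) (hρ : ρ.IsHermitian) (hle : msupp ρ ≤ msupp σ)
    (t : ℝ) : rtr (σ * rotated σ ρ t) = rtr ρ := by
  obtain ⟨U, s, h, hs⟩ := exists_diagonalizes hσ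
  have hdiag : star U * σ * U = Matrix.diagonal (fun i => (s i : ℂ)) := by
    conv_lhs => rw [h.eq]
    simp only [← mul_assoc, h.star_mul, one_mul]
    rw [mul_assoc, h.star_mul, mul_one]
  rw [rtr, rtr, rotated, h.mpow_eq, h.mpow_eq, Diagonalizes.trace_mul_conj_diagonal_mul_mul,
    h.trace_eq_sum ρ, hdiag]
  congr 1
  refine Finset.sum_congr rfl fun i _ => ?_
  rw [Finset.sum_eq_single i]
  · by_cases hi : s i = 0
    · rw [h.coeff_eq_zero hσ hρ hle i i (Or.inl hi)]
      simp
    · have hi' : (s i : ℂ) ≠ 0 := by exact_mod_cast hi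
      rw [if_neg hi, if_neg hi, ← Complex.cpow_add _ _ hi', Matrix.diagonal_apply_eq]
      have : (-(1 + Complex.I * (t : ℂ)) / 2 + -(1 - Complex.I * (t : ℂ)) / 2) = -1 := by ring
      rw [this, Complex.cpow_neg_one]
      field_simp
  · intro j _ hj
    rw [Matrix.diagonal_apply_ne _ hj]
    simp
  · simp

lemma integrable_rotated_and_logDerivKernel (τ : Matrix ι ι ℂ) (hσ : σ.PosSemidef)
    (hρ : ρ.IsHermitian) (hle : msupp ρ ≤ msupp σ) :
    IntegrableOn (fun p => rtr (τ * rotated σ ρ (logisticQuantile p))) (Ioo 0 1) ∧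
    IntegrableOn (logDerivKernel τ σ ρ) (Ioi 0) ∧
    ∫ p in Ioo (0 : ℝ) 1, rtr (τ * rotated σ ρ (logisticQuantile p)) =
      ∫ s in Ioi (0 : ℝ), logDerivKernel τ σ ρ s := by
  obtain ⟨U, s, h, hs⟩ := exists_diagonalizes hσ
  set c : ι → ι → ℂ := fun i j => (star U * τ * U) j i * (star U * ρ * U) i j with hc
  have hc0 : ∀ i j, (s i = 0 ∨ s j = 0) → c i j = 0 := fun i j hij => by
    simp only [hc, h.coeff_eq_zero hσ hρ hle i j hij, mul_zero]
  let F : ι → ι → ℝ → ℂ := fun i j p => c i j *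
    ((if s i = 0 then 0 else (s i : ℂ) ^ (-((1 : ℂ) + Complex.I * (logisticQuantile p : ℂ)) / 2)) *
      (if s j = 0 then 0 else (s j : ℂ) ^ (-((1 : ℂ) - Complex.I * (logisticQuantile p : ℂ)) / 2)))
  let G : ι → ι → ℝ → ℂ := fun i j u => c i j * (((s i + u)⁻¹ * (s j + u)⁻¹ : ℝ) : ℂ)
  have key : ∀ i j, IntegrableOn (F i j) (Ioo 0 1) ∧ IntegrableOn (G i j) (Ioi 0) ∧
      ∫ p in Ioo (0 : ℝ) 1, F i j p = ∫ u in Ioi (0 : ℝ), G i j u := by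
    intro i j
    by_cases hij : s i = 0 ∨ s j = 0
    · simp [F, G, hc0 i j hij]
    · push Not at hij
      have hi := (hs i).lt_of_ne' hij.1
      have hj := (hs j).lt_of_ne' hij.2
      obtain ⟨h1, h2⟩ := integrableOn_and_integral_cpow_mul_cpow hi hj
      have h3 := (integrableOn_resolvent_mul_and_integral hi hj).1
      simp only [F, G, if_neg hij.1, if_neg hij.2]
      refine ⟨h1.const_mul _, h3.ofReal.const_mul _, ?_⟩
      rw [integral_const_mul, integral_const_mul, h2, integral_complex_ofReal]
  have hF : (fun p => rtr (τ * rotated σ ρ (logisticQuantile p))) =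
      fun p => RCLike.re (∑ i, ∑ j, F i j p) := by
    ext p
    rw [rtr, rotated, h.mpow_eq, h.mpow_eq, Diagonalizes.trace_mul_conj_diagonal_mul_mul]
    rfl
  have hG : EqOn (fun u => RCLike.re (∑ i, ∑ j, G i j u)) (logDerivKernel τ σ ρ) (Ioi 0) := by
    intro u hu
    simp only [logDerivKernel, shiftInv]
    rw [(h.isUnit_add_smul_one_and_inv hs hu).2, rtr,
      Diagonalizes.trace_mul_conj_diagonal_mul_mul]
    simp only [G, hc, Complex.ofReal_mul]
    rfl
  have iF : IntegrableOn (fun p => ∑ i, ∑ j, F i j p) (Ioo 0 1) :=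
    integrable_finsetSum _ fun i _ => integrable_finsetSum _ fun j _ => (key i j).1
  have iG : IntegrableOn (fun p => ∑ i, ∑ j, G i j p) (Ioi 0) :=
    integrable_finsetSum _ fun i _ => integrable_finsetSum _ fun j _ => (key i j).2.1
  refine ⟨hF ▸ iF.re, IntegrableOn.congr_fun iG.re hG measurableSet_Ioi, ?_⟩
  rw [hF, ← setIntegral_congr_fun measurableSet_Ioi hG, integral_re iF, integral_re iG]
  congr 1
  rw [integral_finsetSum _ fun i _ => integrable_finsetSum _ fun j _ => (key i j).1,
    integral_finsetSum _ fun i _ => integrable_finsetSum _ fun j _ => (key i j).2.1]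
  refine Finset.sum_congr rfl fun i _ => ?_
  rw [integral_finsetSum _ fun j _ => (key i j).1, integral_finsetSum _ fun j _ => (key i j).2.1]
  exact Finset.sum_congr rfl fun j _ => (key i j).2.2

lemma integral_logDerivKernel_self (hσ : σ.PosSemidef) (hρ : ρ.IsHermitian)
    (hle : msupp ρ ≤ msupp σ) : ∫ s in Ioi (0 : ℝ), logDerivKernel σ σ ρ s = rtr ρ := by
  rw [← (integrable_rotated_and_logDerivKernel σ hσ hρ hle).2.2]
  simp [rtr_self_mul_rotated hσ hρ hle]

lemma integrable_and_integral_eq_rtr_mul_mlog (hσ : σ.PosSemidef)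
    (hρ : ρ.IsHermitian) (hle : msupp ρ ≤ msupp σ) :
    IntegrableOn (fun s => rtr ρ * (1 + s)⁻¹ - rtr (ρ * shiftInv σ s)) (Ioi 0) ∧
    ∫ s in Ioi (0 : ℝ), (rtr ρ * (1 + s)⁻¹ - rtr (ρ * shiftInv σ s)) = rtr (ρ * mlog σ) := by
  obtain ⟨U, s, h, hs⟩ := exists_diagonalizes hσ
  set c : ι → ℝ := fun i => ((star U * ρ * U) i i).re with hc
  let G : ι → ℝ → ℝ := fun i u => c i * ((1 + u)⁻¹ - (s i + u)⁻¹)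
  have key : ∀ i, IntegrableOn (G i) (Ioi 0) ∧
      ∫ u in Ioi (0 : ℝ), G i u = c i * Real.log (s i) := by
    intro i
    by_cases hi : s i = 0
    · simp [G, hc, h.coeff_eq_zero hσ hρ hle i i (Or.inl hi)]
    · obtain ⟨h1, h2⟩ := integrableOn_log_kernel_and_integral ((hs i).lt_of_ne' hi)
      refine ⟨h1.const_mul _, ?_⟩
      rw [integral_const_mul, h2]
  have hG : EqOn (fun u => ∑ i, G i u)
      (fun u => rtr ρ * (1 + u)⁻¹ - rtr (ρ * shiftInv σ u)) (Ioi 0) := by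
    intro u hu
    simp only [G, shiftInv]
    rw [(h.isUnit_add_smul_one_and_inv hs hu).2, rtr, rtr,
      Diagonalizes.trace_mul_conj_diagonal, h.trace_eq_sum ρ, Complex.re_sum, Complex.re_sum,
      Finset.sum_mul, ← Finset.sum_sub_distrib]
    refine Finset.sum_congr rfl fun i _ => ?_
    rw [Complex.re_mul_ofReal, mul_sub]
  have iG : IntegrableOn (fun u => ∑ i, G i u) (Ioi 0) :=
    integrable_finsetSum _ fun i _ => (key i).1
  refine ⟨IntegrableOn.congr_fun iG hG measurableSet_Ioi, ?_⟩
  rw [← setIntegral_congr_fun measurableSet_Ioi hG, integral_finsetSum _ fun i _ => (key i).1,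
    h.mlog_eq, rtr, Diagonalizes.trace_mul_conj_diagonal, Complex.re_sum]
  refine Finset.sum_congr rfl fun i _ => ?_
  rw [(key i).2, Complex.re_mul_ofReal]

lemma rtr_mul_shiftInv_sub_le (hσ : σ.PosSemidef) (hτ : τ.PosSemidef) (hρ : ρ.PosSemidef)
    {s : ℝ} (hs : 0 < s) :
    rtr (ρ * shiftInv σ s) - rtr (ρ * shiftInv τ s) ≤
      logDerivKernel τ σ ρ s - logDerivKernel σ σ ρ s := by
  obtain ⟨U, a, h, ha⟩ := exists_diagonalizes hσ
  obtain ⟨V, b, h', hb⟩ := exists_diagonalizes hτ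
  have u1 := (h.isUnit_add_smul_one_and_inv ha hs).1
  have u2 := (h'.isUnit_add_smul_one_and_inv hb hs).1
  set A := σ + (s : ℂ) • (1 : Matrix ι ι ℂ) with hA
  set B := τ + (s : ℂ) • (1 : Matrix ι ι ℂ) with hB
  have a1 : A⁻¹ * A = 1 := Matrix.nonsing_inv_mul _ ((Matrix.isUnit_iff_isUnit_det _).1 u1)
  have b1 : B⁻¹ * B = 1 := Matrix.nonsing_inv_mul _ ((Matrix.isUnit_iff_isUnit_det _).1 u2)
  have b2 : B * B⁻¹ = 1 := Matrix.mul_nonsing_inv _ ((Matrix.isUnit_iff_isUnit_det _).1 u2)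
  have hs1 : ((s : ℂ) • (1 : Matrix ι ι ℂ)).PosSemidef :=
    Matrix.PosSemidef.one.smul (by exact_mod_cast hs.le)
  have hBp : B.PosSemidef := hτ.add hs1
  have hAp : A.PosSemidef := hσ.add hs1
  have hH : (B⁻¹ - A⁻¹).conjTranspose = B⁻¹ - A⁻¹ := by
    rw [Matrix.conjTranspose_sub, hBp.inv.1.eq, hAp.inv.1.eq]
  have hpos := hBp.mul_mul_conjTranspose_same (B⁻¹ - A⁻¹)
  rw [hH] at hpos
  have hnn := rtr_mul_nonneg hρ hpos
  have e1 : (B⁻¹ - A⁻¹) * B * (B⁻¹ - A⁻¹) = B⁻¹ - A⁻¹ + (A⁻¹ * τ * A⁻¹ - A⁻¹ * σ * A⁻¹) := by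
    have e2 : τ = B - A + σ := by
      rw [hA, hB]
      abel
    rw [e2]
    simp only [sub_mul, mul_sub, mul_add, add_mul, b1, a1, one_mul]
    rw [mul_assoc A⁻¹ B B⁻¹, b2, mul_one]
    abel
  have e3 : ∀ X : Matrix ι ι ℂ, rtr (X * (A⁻¹ * ρ * A⁻¹)) = rtr (ρ * (A⁻¹ * X * A⁻¹)) := by
    intro X
    simp only [rtr]
    rw [← mul_assoc, Matrix.trace_mul_comm, ← mul_assoc, ← mul_assoc, Matrix.trace_mul_comm,
      ← mul_assoc]
  rw [e1, mul_add, mul_sub, mul_sub, rtr_add, rtr_sub, rtr_sub] at hnn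
  simp only [logDerivKernel, shiftInv]
  rw [← hA, ← hB, e3, e3]
  linarith

/-- The tangent inequality for the concave function `σ ↦ Tr[ρ log σ]`. -/
lemma rtr_mul_mlog_sub_le (hσ : σ.PosSemidef) (hτ : τ.PosSemidef) (hρ : ρ.PosSemidef)
    (hρσ : msupp ρ ≤ msupp σ) (hρτ : msupp ρ ≤ msupp τ) :
    rtr (ρ * mlog τ) - rtr (ρ * mlog σ) ≤
      (∫ s in Ioi (0 : ℝ), logDerivKernel τ σ ρ s) - rtr ρ := by
  obtain ⟨i1, e1⟩ := integrable_and_integral_eq_rtr_mul_mlog hσ hρ.1 hρσ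
  obtain ⟨i2, e2⟩ := integrable_and_integral_eq_rtr_mul_mlog hτ hρ.1 hρτ
  have i3 := (integrable_rotated_and_logDerivKernel τ hσ hρ.1 hρσ).2.1
  have i4 := (integrable_rotated_and_logDerivKernel σ hσ hρ.1 hρσ).2.1
  rw [← integral_logDerivKernel_self hσ hρ.1 hρσ, ← e1, ← e2, ← integral_sub i2 i1,
    ← integral_sub i3 i4]
  refine setIntegral_mono_on (i2.sub i1) (i3.sub i4) measurableSet_Ioi fun s hs => ?_
  have := rtr_mul_shiftInv_sub_le hσ hτ hρ hs
  linarith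

lemma logDerivKernel_nonneg (hσ : σ.PosSemidef) (hτ : τ.PosSemidef) (hρ : ρ.PosSemidef)
    {s : ℝ} (hs : 0 < s) : 0 ≤ logDerivKernel τ σ ρ s := by
  have hp : (shiftInv σ s).PosSemidef :=
    (hσ.add (Matrix.PosSemidef.one.smul (a := (s : ℂ)) (by exact_mod_cast hs.le))).inv
  have h := hρ.mul_mul_conjTranspose_same (shiftInv σ s)
  rw [hp.1.eq] at h
  exact rtr_mul_nonneg hτ h

lemma tendsto_logDerivKernel {σs : ℕ → Matrix ι ι ℂ} (hσ : σ.PosSemidef)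
    (hlim : Tendsto σs atTop (nhds σ)) {s : ℝ} (hs : 0 < s) :
    Tendsto (fun k => logDerivKernel τ (σs k) ρ s) atTop (nhds (logDerivKernel τ σ ρ s)) := by
  obtain ⟨U, a, h, ha⟩ := exists_diagonalizes hσ
  have hdet : IsUnit (σ + (s : ℂ) • 1).det :=
    (Matrix.isUnit_iff_isUnit_det _).1 (h.isUnit_add_smul_one_and_inv ha hs).1
  have hinv : Tendsto (fun k => shiftInv (σs k) s) atTop (nhds (shiftInv σ s)) := by
    refine (continuousAt_matrix_inv (σ + (s : ℂ) • 1) ?_).tendsto.comp (hlim.add_const _)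
    exact NormedRing.inverse_continuousAt hdet.unit
  have hcont : Continuous (fun X : Matrix ι ι ℂ => rtr (τ * (X * ρ * X))) := by
    unfold rtr
    refine Complex.continuous_re.comp (Continuous.matrix_trace ?_)
    fun_prop
  exact (hcont.tendsto _).comp hinv

lemma integral_le_of_tendsto_of_nonneg {f : ℕ → ℝ → ℝ} {g : ℝ → ℝ} {C : ℝ}
    (hf : ∀ k, IntegrableOn (f k) (Ioi 0)) (hg : IntegrableOn g (Ioi 0))
    (hf0 : ∀ k, ∀ s ∈ Ioi (0 : ℝ), 0 ≤ f k s)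
    (hlim : ∀ s ∈ Ioi (0 : ℝ), Tendsto (fun k => f k s) atTop (nhds (g s)))
    (hC : ∀ k, ∫ s in Ioi (0 : ℝ), f k s ≤ C) : ∫ s in Ioi (0 : ℝ), g s ≤ C := by
  have hg0 : ∀ s ∈ Ioi (0 : ℝ), 0 ≤ g s := fun s hs =>
    ge_of_tendsto' (hlim s hs) fun k => hf0 k s hs
  have hC0 : 0 ≤ C := (setIntegral_nonneg measurableSet_Ioi (hf0 0)).trans (hC 0)
  rw [← ENNReal.ofReal_le_ofReal_iff hC0, ofReal_integral_eq_lintegral_ofReal hg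
    (ae_restrict_of_forall_mem measurableSet_Ioi hg0)]
  calc ∫⁻ s in Ioi (0 : ℝ), ENNReal.ofReal (g s)
      = ∫⁻ s in Ioi (0 : ℝ), liminf (fun k => ENNReal.ofReal (f k s)) atTop := by
        refine setLIntegral_congr_fun measurableSet_Ioi fun s hs => ?_
        exact (((ENNReal.continuous_ofReal.tendsto _).comp (hlim s hs)).liminf_eq).symm
    _ ≤ liminf (fun k => ∫⁻ s in Ioi (0 : ℝ), ENNReal.ofReal (f k s)) atTop :=
        lintegral_liminf_le' fun k => (hf k).aestronglyMeasurable.aemeasurable.ennreal_ofReal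
    _ ≤ liminf (fun _ : ℕ => ENNReal.ofReal C) atTop := by
        refine liminf_le_liminf (Eventually.of_forall fun k => ?_)
        rw [← ofReal_integral_eq_lintegral_ofReal (hf k)
          (ae_restrict_of_forall_mem measurableSet_Ioi (hf0 k))]
        exact ENNReal.ofReal_le_ofReal (hC k)
    _ = ENNReal.ofReal C := by simp

/-- First-order optimality condition for the maximization of `Tr[ρ log σ]` over a convex set. -/
lemma integral_logDerivKernel_le_of_isMaxOn {S : Set (Matrix ι ι ℂ)} (hS : Convex ℝ S)
    (hpsd : ∀ X ∈ S, X.PosSemidef) (hρ : ρ.PosSemidef) (hσS : σ ∈ S) (hτS : τ ∈ S)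
    (hρσ : msupp ρ ≤ msupp σ)
    (hmax : ∀ X ∈ S, msupp ρ ≤ msupp X → rtr (ρ * mlog X) ≤ rtr (ρ * mlog σ)) :
    ∫ s in Ioi (0 : ℝ), logDerivKernel τ σ ρ s ≤ rtr ρ := by
  have hσ := hpsd σ hσS
  have hτ := hpsd τ hτS
  set ε : ℕ → ℝ := fun k => 1 / ((k : ℝ) + 2) with hε
  have hε0 : ∀ k, 0 < ε k := fun k => by positivity
  have hε1 : ∀ k, 0 < 1 - ε k := fun k => by
    have h2 : (0 : ℝ) ≤ k := k.cast_nonneg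
    rw [sub_pos, hε, div_lt_one (by positivity)]
    linarith
  set σs : ℕ → Matrix ι ι ℂ := fun k => (1 - ε k) • σ + ε k • τ with hσs
  have hmem : ∀ k, σs k ∈ S := fun k =>
    hS hσS hτS (hε1 k).le (hε0 k).le (by ring)
  have hsupp : ∀ k, msupp ρ ≤ msupp (σs k) := fun k =>
    msupp_le_add hρ.1 hσ hτ hρσ (hε1 k) (hε0 k).le
  have hεlim : Tendsto ε atTop (nhds 0) := by
    have := (tendsto_one_div_add_atTop_nhds_zero_nat (𝕜 := ℝ)).comp (tendsto_add_atTop_nat 1)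
    refine this.congr fun k => ?_
    simp only [hε, Function.comp]
    push_cast
    ring
  have hlim : Tendsto σs atTop (nhds σ) := by
    have := ((hεlim.const_sub 1).smul_const σ).add (hεlim.smul_const τ)
    simpa using this
  refine integral_le_of_tendsto_of_nonneg (f := fun k => logDerivKernel τ (σs k) ρ)
    (fun k => (integrable_rotated_and_logDerivKernel τ (hpsd _ (hmem k)) hρ.1 (hsupp k)).2.1)
    (integrable_rotated_and_logDerivKernel τ hσ hρ.1 hρσ).2.1
    (fun k s hs => logDerivKernel_nonneg (hpsd _ (hmem k)) hτ hρ hs)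
    (fun s hs => tendsto_logDerivKernel hσ hlim hs) fun k => ?_
  have hk := hpsd _ (hmem k)
  have h1 := rtr_mul_mlog_sub_le hk hσ hρ (hsupp k) hρσ
  have h2 := hmax _ (hmem k) (hsupp k)
  have h3 := integral_logDerivKernel_self hk hρ.1 (hsupp k)
  have h4 : ∀ s, logDerivKernel (σs k) (σs k) ρ s =
      (1 - ε k) * logDerivKernel σ (σs k) ρ s + ε k * logDerivKernel τ (σs k) ρ s := by
    intro s
    have : ∀ M : Matrix ι ι ℂ, rtr (σs k * M) = (1 - ε k) * rtr (σ * M) + ε k * rtr (τ * M) := by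
      intro M
      rw [hσs]
      simp only
      rw [add_mul, rtr_add, smul_mul_assoc, smul_mul_assoc, rtr_smul, rtr_smul]
    exact this _
  have i1 := (integrable_rotated_and_logDerivKernel σ hk hρ.1 (hsupp k)).2.1
  have i2 := (integrable_rotated_and_logDerivKernel τ hk hρ.1 (hsupp k)).2.1
  simp only [h4] at h3
  rw [integral_add (i1.const_mul _) (i2.const_mul _), integral_const_mul, integral_const_mul] at h3
  have h5 : (1 - ε k) * rtr ρ ≤ (1 - ε k) * ∫ s in Ioi (0 : ℝ), logDerivKernel σ (σs k) ρ s :=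
    mul_le_mul_of_nonneg_left (by linarith) (hε1 k).le
  refine le_of_mul_le_mul_left ?_ (hε0 k)
  linarith

end Integrals

/-! ### Tensor powers -/

section TensorPower

variable {d : ℕ}

lemma tpow_mul (A B : Matrix (Fin d) (Fin d) ℂ) (n : ℕ) :
    tpow (A * B) n = tpow A n * tpow B n := by
  ext x y
  simp only [tpow, Matrix.of_apply, Matrix.mul_apply]
  rw [Finset.prod_univ_sum, Fintype.piFinset_univ]
  simp only [Finset.prod_mul_distrib]

lemma tpow_star (A : Matrix (Fin d) (Fin d) ℂ) (n : ℕ) : tpow (star A) n = star (tpow A n) := by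
  ext x y
  simp [tpow, Matrix.star_apply]

lemma tpow_diagonal (f : Fin d → ℂ) (n : ℕ) :
    tpow (Matrix.diagonal f) n = Matrix.diagonal (fun x => ∏ i, f (x i)) := by
  ext x y
  simp only [tpow, Matrix.of_apply]
  by_cases hxy : x = y
  · subst hxy
    simp
  · obtain ⟨i, hi⟩ := Function.ne_iff.1 hxy
    rw [Matrix.diagonal_apply_ne _ hxy]
    exact Finset.prod_eq_zero (Finset.mem_univ i) (Matrix.diagonal_apply_ne _ hi)

lemma tpow_one_matrix (n : ℕ) : tpow (1 : Matrix (Fin d) (Fin d) ℂ) n = 1 := by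
  rw [← Matrix.diagonal_one, tpow_diagonal]
  simp

lemma trace_tpow (A : Matrix (Fin d) (Fin d) ℂ) (n : ℕ) : (tpow A n).trace = A.trace ^ n := by
  have := (Finset.prod_univ_sum (fun _ : Fin n => (Finset.univ : Finset (Fin d)))
    (fun _ i => A i i)).symm
  rw [Fintype.piFinset_univ, Finset.prod_const, Finset.card_univ, Fintype.card_fin] at this
  exact this

lemma tensOp_tpow (A : Matrix (Fin d) (Fin d) ℂ) (m n : ℕ) :
    tensOp (tpow A m) (tpow A n) = tpow A (m + n) := by
  ext x y
  simp [tensOp, tpow, Fin.prod_univ_add]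

lemma Diagonalizes.tpow {A U : Matrix (Fin d) (Fin d) ℂ} {a : Fin d → ℝ} (h : Diagonalizes A U a)
    (n : ℕ) : Diagonalizes (tpow A n) (tpow U n) (fun x => ∏ i, a (x i)) where
  star_mul := by rw [← tpow_star, ← tpow_mul, h.star_mul, tpow_one_matrix]
  mul_star := by rw [← tpow_star, ← tpow_mul, h.mul_star, tpow_one_matrix]
  eq := by
    conv_lhs => rw [h.eq]
    rw [tpow_mul, tpow_mul, tpow_diagonal, tpow_star]
    simp only [Complex.ofReal_prod]

lemma Diagonalizes.posSemidef {ι : Type*} [Fintype ι] [DecidableEq ι] {A U : Matrix ι ι ℂ}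
    {a : ι → ℝ} (h : Diagonalizes A U a) (ha : ∀ i, 0 ≤ a i) : A.PosSemidef := by
  rw [h.eq, Matrix.star_eq_conjTranspose]
  exact (Matrix.PosSemidef.diagonal fun i => by
    simpa using ha i).mul_mul_conjTranspose_same U

lemma posSemidef_tpow {A : Matrix (Fin d) (Fin d) ℂ} (hA : A.PosSemidef) (n : ℕ) :
    (tpow A n).PosSemidef := by
  obtain ⟨U, a, h, ha⟩ := exists_diagonalizes hA
  exact (h.tpow n).posSemidef fun x => Finset.prod_nonneg fun i _ => ha _

lemma prod_ofReal_cpow {κ : Type*} (s : Finset κ) (f : κ → ℝ) (hf : ∀ i, 0 ≤ f i) (w : ℂ) :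
    (if ∏ i ∈ s, f i = 0 then 0 else ((∏ i ∈ s, f i : ℝ) : ℂ) ^ w) =
      ∏ i ∈ s, if f i = 0 then 0 else (f i : ℂ) ^ w := by
  induction s using Finset.induction_on with
  | empty => simp
  | insert i s hi ih =>
    rw [Finset.prod_insert hi, Finset.prod_insert hi, ← ih]
    by_cases h1 : f i = 0
    · simp [h1]
    by_cases h2 : ∏ j ∈ s, f j = 0
    · simp [h2]
    · rw [if_neg (mul_ne_zero h1 h2), if_neg h1, if_neg h2, Complex.ofReal_mul,
        Complex.mul_cpow_ofReal_nonneg (hf i) (Finset.prod_nonneg fun j _ => hf j)]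

lemma mpow_tpow {A : Matrix (Fin d) (Fin d) ℂ} (hA : A.PosSemidef) (n : ℕ) (w : ℂ) :
    mpow (tpow A n) w = tpow (mpow A w) n := by
  obtain ⟨U, a, h, ha⟩ := exists_diagonalizes hA
  rw [(h.tpow n).mpow_eq, h.mpow_eq, tpow_mul, tpow_mul, tpow_diagonal, tpow_star]
  congr 3
  ext x
  exact prod_ofReal_cpow Finset.univ (fun i => a (x i)) (fun i => ha _) w

lemma rotated_tpow {σ : Matrix (Fin d) (Fin d) ℂ} (hσ : σ.PosSemidef)
    (ρ : Matrix (Fin d) (Fin d) ℂ) (n : ℕ) (t : ℝ) :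
    rotated (tpow σ n) (tpow ρ n) t = tpow (rotated σ ρ t) n := by
  rw [rotated, rotated, mpow_tpow hσ, mpow_tpow hσ, ← tpow_mul, ← tpow_mul]

lemma msupp_tpow_le {ρ σ : Matrix (Fin d) (Fin d) ℂ} (hσ : σ.PosSemidef)
    (hle : msupp ρ ≤ msupp σ) (n : ℕ) : msupp (tpow ρ n) ≤ msupp (tpow σ n) := by
  rw [msupp_le_iff_mpow_zero_mul hσ] at hle
  rw [msupp_le_iff_mpow_zero_mul (posSemidef_tpow hσ n), mpow_tpow hσ, ← tpow_mul, hle]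

lemma sum_prod_mul_apply {n : ℕ} (q v : Fin d → ℂ) (hq : ∑ k, q k = 1) (i : Fin n) :
    ∑ x : Fin n → Fin d, (∏ j, q (x j)) * v (x i) = ∑ k, q k * v k := by
  have h := (Finset.prod_univ_sum (fun _ : Fin n => (Finset.univ : Finset (Fin d)))
    (fun j k => q k * if j = i then v k else 1)).symm
  rw [Fintype.piFinset_univ] at h
  have h1 : ∀ x : Fin n → Fin d, (∏ j, q (x j)) * v (x i) =
      ∏ j, (q (x j) * if j = i then v (x j) else 1) := fun x => by
    rw [Finset.prod_mul_distrib, Finset.prod_ite_eq' Finset.univ i (fun j => v (x j)),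
      if_pos (Finset.mem_univ i)]
  rw [Finset.sum_congr rfl fun x _ => h1 x, h, Finset.prod_eq_single i]
  · simp
  · intro j _ hj
    simp [hj, hq]
  · simp

lemma rtr_tpow_mul_mlog {ρ σ : Matrix (Fin d) (Fin d) ℂ} (hρ : IsState ρ) (hσ : σ.PosSemidef)
    (hle : msupp ρ ≤ msupp σ) (n : ℕ) :
    rtr (tpow ρ n * mlog (tpow σ n)) = n * rtr (ρ * mlog σ) := by
  obtain ⟨U, s, h, hs⟩ := exists_diagonalizes hσ
  set q : Fin d → ℂ := fun k => (star U * ρ * U) k k with hq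
  have hq1 : ∑ k, q k = 1 := by rw [hq, ← h.trace_eq_sum, hρ.2]
  have hqn : ∀ x, (star (tpow U n) * tpow ρ n * tpow U n) x x = ∏ i, q (x i) := fun x => by
    rw [← tpow_star, ← tpow_mul, ← tpow_mul]
    rfl
  have hlog : ∀ x : Fin n → Fin d, (∏ i, q (x i)) * (Real.log (∏ i, s (x i)) : ℂ) =
      ∑ i, (∏ j, q (x j)) * (Real.log (s (x i)) : ℂ) := fun x => by
    by_cases hx : ∃ i, s (x i) = 0
    · obtain ⟨i, hi⟩ := hx
      have : ∏ j, q (x j) = 0 := Finset.prod_eq_zero (Finset.mem_univ i)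
        (h.coeff_eq_zero hσ hρ.1.1 hle _ _ (Or.inl hi))
      simp [this]
    · push Not at hx
      rw [Real.log_prod fun i _ => hx i, Complex.ofReal_sum, Finset.mul_sum]
  have key : (tpow ρ n * mlog (tpow σ n)).trace = n * (ρ * mlog σ).trace := by
    rw [(h.tpow n).mlog_eq, h.mlog_eq, Diagonalizes.trace_mul_conj_diagonal,
      Diagonalizes.trace_mul_conj_diagonal]
    simp only [hqn, hlog]
    rw [Finset.sum_comm]
    simp only [sum_prod_mul_apply q (fun k => (Real.log (s k) : ℂ)) hq1]
    simp [hq]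
  rw [rtr, key, rtr, ← Complex.ofReal_natCast, Complex.re_ofReal_mul]

lemma isState_tpow {ρ : Matrix (Fin d) (Fin d) ℂ} (hρ : IsState ρ) (n : ℕ) :
    IsState (tpow ρ n) :=
  ⟨posSemidef_tpow hρ.1 n, by rw [trace_tpow, hρ.2, one_pow]⟩

lemma IsState.rtr_eq {ι : Type*} [Fintype ι] {ρ : Matrix ι ι ℂ} (hρ : IsState ρ) :
    rtr ρ = 1 := by rw [rtr, hρ.2, Complex.one_re]

lemma relEnt_of_le {ι : Type*} [Fintype ι] [DecidableEq ι] {ρ σ : Matrix ι ι ℂ}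
    (hle : msupp ρ ≤ msupp σ) :
    relEnt ρ σ = ((rtr (ρ * mlog ρ) - rtr (ρ * mlog σ) : ℝ) : EReal) := by
  rw [relEnt, if_pos hle, mul_sub, rtr_sub]

lemma relEnt_tpow {ρ σ : Matrix (Fin d) (Fin d) ℂ} (hρ : IsState ρ) (hσ : σ.PosSemidef)
    (hle : msupp ρ ≤ msupp σ) (n : ℕ) :
    relEnt (tpow ρ n) (tpow σ n) =
      ((n * (rtr (ρ * mlog ρ) - rtr (ρ * mlog σ)) : ℝ) : EReal) := by
  rw [relEnt_of_le (msupp_tpow_le hσ hle n), rtr_tpow_mul_mlog hρ hσ hle,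
    rtr_tpow_mul_mlog hρ hρ.1 le_rfl, mul_sub]

/-- An operator on `H^{⊗1}`, seen as an operator on `H`. -/
def flatten (X : Matrix (Fin 1 → Fin d) (Fin 1 → Fin d) ℂ) : Matrix (Fin d) (Fin d) ℂ :=
  X.submatrix (fun i _ => i) (fun j _ => j)

lemma tpow_flatten (X : Matrix (Fin 1 → Fin d) (Fin 1 → Fin d) ℂ) : tpow (flatten X) 1 = X := by
  ext x y
  simp only [tpow, flatten, Matrix.of_apply, Finset.univ_unique, Finset.prod_singleton,
    Matrix.submatrix_apply]
  congr 1 <;> ext i <;> rw [Subsingleton.elim i default]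

lemma flatten_tpow (A : Matrix (Fin d) (Fin d) ℂ) : flatten (tpow A 1) = A := by
  ext i j
  simp [tpow, flatten]

lemma msupp_flatten_le {ρ : Matrix (Fin d) (Fin d) ℂ}
    {σ : Matrix (Fin 1 → Fin d) (Fin 1 → Fin d) ℂ} (hσ : σ.PosSemidef)
    (hle : msupp (tpow ρ 1) ≤ msupp σ) : msupp ρ ≤ msupp (flatten σ) := by
  have hσ' : (flatten σ).PosSemidef := hσ.submatrix _
  rw [msupp_le_iff_mpow_zero_mul hσ] at hle
  rw [msupp_le_iff_mpow_zero_mul hσ']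
  rw [← tpow_flatten σ, mpow_tpow hσ', ← tpow_mul] at hle
  simpa only [flatten_tpow] using congr_arg flatten hle

lemma tpow_mem_of_tensOp_mem {S : (n : ℕ) → Set (Matrix (Fin n → Fin d) (Fin n → Fin d) ℂ)}
    (hS : ∀ n, 1 ≤ n → ∀ A ∈ S n, ∀ B ∈ S 1, tensOp A B ∈ S (n + 1))
    {A : Matrix (Fin d) (Fin d) ℂ} (hA : tpow A 1 ∈ S 1) {n : ℕ} (hn : 1 ≤ n) :
    tpow A n ∈ S n := by
  induction n, hn using Nat.le_induction with
  | base => exact hA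
  | succ n hn ih =>
    rw [← tensOp_tpow]
    exact hS n hn _ ih _ hA

end TensorPower

/-! ### The additivity criterion -/

section Additivity

lemma continuous_rtr_mul_rotated {ι : Type*} [Fintype ι] [DecidableEq ι] {σ : Matrix ι ι ℂ}
    (hσ : σ.IsHermitian) (τ ρ : Matrix ι ι ℂ) :
    Continuous fun t => rtr (τ * rotated σ ρ t) := by
  have hpow : ∀ w : ℝ → ℂ, Continuous w → Continuous fun t => mpow σ (w t) := by
    intro w hw
    simp only [(diagonalizes_eigenvectorUnitary hσ).mpow_eq]
    refine (continuous_const.matrix_mul (Continuous.matrix_diagonal ?_)).matrix_mul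
      continuous_const
    refine continuous_pi fun i => ?_
    by_cases hi : hσ.eigenvalues i = 0
    · simp [hi, continuous_const]
    · simp only [if_neg hi]
      exact hw.const_cpow (Or.inl (by exact_mod_cast hi))
  have h := (((hpow (fun t : ℝ => -((1 : ℂ) + Complex.I * (t : ℂ)) / 2)
    (by fun_prop)).matrix_mul (continuous_const (y := ρ))).matrix_mul
      (hpow (fun t : ℝ => -((1 : ℂ) - Complex.I * (t : ℂ)) / 2) (by fun_prop)))
  exact Complex.continuous_re.comp (((continuous_const (y := τ)).matrix_mul h).matrix_trace)

lemma le_one_of_integral_pow_le_one {g : ℝ → ℝ} (hg : ContinuousOn g (Ioo 0 1))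
    (hg0 : ∀ p ∈ Ioo (0 : ℝ) 1, 0 ≤ g p)
    (hgi : ∀ n : ℕ, 1 ≤ n → IntegrableOn (fun p => g p ^ n) (Ioo 0 1))
    (hle : ∀ n : ℕ, 1 ≤ n → ∫ p in Ioo (0 : ℝ) 1, g p ^ n ≤ 1) {p : ℝ} (hp : p ∈ Ioo (0 : ℝ) 1) :
    g p ≤ 1 := by
  by_contra! hlt
  obtain ⟨c, hc1, hc⟩ := exists_between hlt
  set U : Set ℝ := Ioo 0 1 ∩ g ⁻¹' Ioi c with hU
  have hUo : IsOpen U := hg.isOpen_inter_preimage isOpen_Ioo isOpen_Ioi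
  have hUfin : volume U ≠ ⊤ :=
    ((measure_mono inter_subset_left).trans_lt measure_Ioo_lt_top).ne
  have hm : 0 < volume.real U :=
    ENNReal.toReal_pos (hUo.measure_pos volume ⟨p, hp, hc⟩).ne' hUfin
  have hbound : ∀ n : ℕ, 1 ≤ n → c ^ n * volume.real U ≤ 1 := fun n hn => calc
    c ^ n * volume.real U = ∫ _ in U, c ^ n := by
      rw [setIntegral_const, smul_eq_mul, mul_comm]
    _ ≤ ∫ p in U, g p ^ n :=
      setIntegral_mono_on (integrableOn_const hUfin) ((hgi n hn).mono_set inter_subset_left)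
        hUo.measurableSet fun q hq => pow_le_pow_left₀ (by linarith) (le_of_lt hq.2) n
    _ ≤ ∫ p in Ioo (0 : ℝ) 1, g p ^ n :=
      setIntegral_mono_set (hgi n hn)
        ((ae_restrict_iff' measurableSet_Ioo).2 (ae_of_all _ fun q hq => pow_nonneg (hg0 q hq) n))
        inter_subset_left.eventuallyLE
    _ ≤ 1 := hle n hn
  obtain ⟨n, hn1, hn⟩ := (((tendsto_pow_atTop_atTop_of_one_lt hc1).atTop_mul_const hm
    |>.eventually_gt_atTop 1).and (eventually_ge_atTop 1)).exists
  exact absurd (hbound n hn) (not_le.2 hn1)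

variable {d : ℕ} {ρ σ τ : Matrix (Fin d) (Fin d) ℂ}

lemma rtr_tpow_mul_rotated_tpow (hσ : σ.PosSemidef) (hρ : ρ.PosSemidef) (hτ : τ.PosSemidef)
    (n : ℕ) (t : ℝ) :
    rtr (tpow τ n * rotated (tpow σ n) (tpow ρ n) t) = rtr (τ * rotated σ ρ t) ^ n := by
  have h := trace_mul_nonneg hτ (posSemidef_rotated hσ hρ t)
  have h' : (τ * rotated σ ρ t).trace = (rtr (τ * rotated σ ρ t) : ℂ) :=
    Complex.ext (Complex.ofReal_re _).symm
      ((Complex.nonneg_iff.1 h).2.symm.trans (Complex.ofReal_im _).symm)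
  rw [rotated_tpow hσ, ← tpow_mul, rtr, trace_tpow, h', ← Complex.ofReal_pow, Complex.ofReal_re]

/-- If every power `σ^{⊗n}` maximizes `Tr[ρ^{⊗n} log X]` over `S n`, then
`σ^{-(1+it)/2} ρ σ^{-(1-it)/2}` lies in the polar of the one-copy set. -/
lemma rtr_mul_rotated_le_one {S : (n : ℕ) → Set (Matrix (Fin n → Fin d) (Fin n → Fin d) ℂ)}
    (hS : Assumption1 S) (hρ : IsState ρ) (hσ : σ.PosSemidef) (hτ : τ.PosSemidef)
    (hσS : tpow σ 1 ∈ S 1) (hτS : tpow τ 1 ∈ S 1) (hle : msupp ρ ≤ msupp σ)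
    (hmax : ∀ n, 1 ≤ n → ∀ X ∈ S n, msupp (tpow ρ n) ≤ msupp X →
      rtr (tpow ρ n * mlog X) ≤ rtr (tpow ρ n * mlog (tpow σ n))) (t : ℝ) :
    rtr (τ * rotated σ ρ t) ≤ 1 := by
  have htens : ∀ n, 1 ≤ n → ∀ A ∈ S n, ∀ B ∈ S 1, tensOp A B ∈ S (n + 1) :=
    fun n hn => hS.tens n 1 hn le_rfl
  obtain ⟨p, hp, rfl⟩ := exists_logisticQuantile_eq t
  have hgi := fun n => integrable_rotated_and_logDerivKernel (tpow τ n) (posSemidef_tpow hσ n)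
    (posSemidef_tpow hρ.1 n).1 (msupp_tpow_le hσ hle n)
  simp only [rtr_tpow_mul_rotated_tpow hσ hρ.1 hτ] at hgi
  refine le_one_of_integral_pow_le_one (g := fun p => rtr (τ * rotated σ ρ (logisticQuantile p)))
    ((continuous_rtr_mul_rotated hσ.1 τ ρ).comp_continuousOn continuousOn_logisticQuantile)
    (fun q _ => rtr_mul_nonneg hτ (posSemidef_rotated hσ hρ.1 _)) (fun n _ => (hgi n).1)
    (fun n hn => ?_) hp
  rw [(hgi n).2.2, ← (isState_tpow hρ n).rtr_eq]
  exact integral_logDerivKernel_le_of_isMaxOn (hS.convex n hn) (hS.psd n hn)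
    (posSemidef_tpow hρ.1 n) (tpow_mem_of_tensOp_mem htens hσS hn)
    (tpow_mem_of_tensOp_mem htens hτS hn) (msupp_tpow_le hσ hle n) (hmax n hn)

/-- If `σ^{-(1+it)/2} ρ σ^{-(1-it)/2}` lies in the polar of the one-copy set for all `t`, then
`σ^{⊗n}` maximizes `Tr[ρ^{⊗n} log X]` over `S n`. -/
lemma rtr_mul_mlog_le_of_rotated_mem_polar
    {S : (n : ℕ) → Set (Matrix (Fin n → Fin d) (Fin n → Fin d) ℂ)}
    (hS : Assumption1 S) (hρ : IsState ρ) (hσ : σ.PosSemidef) (hle : msupp ρ ≤ msupp σ)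
    (hpolar : ∀ t, tpow (rotated σ ρ t) 1 ∈ polar (S 1)) {n : ℕ} (hn : 1 ≤ n)
    {X : Matrix (Fin n → Fin d) (Fin n → Fin d) ℂ} (hX : X ∈ S n)
    (hρX : msupp (tpow ρ n) ≤ msupp X) :
    rtr (tpow ρ n * mlog X) ≤ rtr (tpow ρ n * mlog (tpow σ n)) := by
  have hmem : ∀ t, tpow (rotated σ ρ t) n ∈ polar (S n) := fun t =>
    tpow_mem_of_tensOp_mem (S := fun n => polar (S n))
      (fun n hn => hS.polarTens n 1 hn le_rfl) (hpolar t) hn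
  obtain ⟨h1, -, h2⟩ := integrable_rotated_and_logDerivKernel X (posSemidef_tpow hσ n)
    (posSemidef_tpow hρ.1 n).1 (msupp_tpow_le hσ hle n)
  have h3 := rtr_mul_mlog_sub_le (posSemidef_tpow hσ n) (hS.psd n hn X hX)
    (posSemidef_tpow hρ.1 n) (msupp_tpow_le hσ hle n) hρX
  have h4 : ∫ p in Ioo (0 : ℝ) 1,
      rtr (X * rotated (tpow σ n) (tpow ρ n) (logisticQuantile p)) ≤ 1 := by
    calc _ ≤ ∫ _ in Ioo (0 : ℝ) 1, (1 : ℝ) := by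
          refine setIntegral_mono h1 (integrableOn_const measure_Ioo_lt_top.ne) fun p => ?_
          have := (hmem (logisticQuantile p)).2 X hX
          rwa [rtr, Matrix.trace_mul_comm, ← rotated_tpow hσ, ← rtr] at this
      _ = 1 := by simp
  rw [← h2, (isState_tpow hρ n).rtr_eq] at h3
  linarith

end Additivity

/-- Theorem 3 of the paper: single-copy criterion for weak additivity of
the minimized Umegaki relative entropy. -/
theorem umegaki_weak_additivity_iff {d : ℕ}
    (ρ : Matrix (Fin d) (Fin d) ℂ) (hρ : IsState ρ)
    (S : (n : ℕ) → Set (Matrix (Fin n → Fin d) (Fin n → Fin d) ℂ))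
    (hS : Assumption1 S)
    (hsupp : ∃ τ ∈ S 1, IsState τ ∧ msupp (tpow ρ 1) ≤ msupp τ)
    (σ₀ : Matrix (Fin 1 → Fin d) (Fin 1 → Fin d) ℂ) (hσ₀ : σ₀ ∈ S 1)
    (hmin : ∀ σ ∈ S 1, relEnt (tpow ρ 1) σ₀ ≤ relEnt (tpow ρ 1) σ) :
    (∀ n : ℕ, 1 ≤ n →
        (⨅ σ ∈ S n, relEnt (tpow ρ n) σ) =
          ((n : ℝ) : EReal) * ⨅ σ ∈ S 1, relEnt (tpow ρ 1) σ) ↔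
      (⨆ t : ℝ, ⨆ τ ∈ S 1,
        ((rtr (τ * (mpow σ₀ (-((1 : ℂ) + Complex.I * (t : ℂ)) / 2) * tpow ρ 1 *
          mpow σ₀ (-((1 : ℂ) - Complex.I * (t : ℂ)) / 2))) : ℝ) : EReal)) = 1 := by
  have hρ1 : IsState (tpow ρ 1) := isState_tpow hρ 1
  have hσ₀p := hS.psd 1 le_rfl σ₀ hσ₀
  have hle₀ : msupp (tpow ρ 1) ≤ msupp σ₀ := by
    obtain ⟨τ, hτ, -, hle⟩ := hsupp
    by_contra hnot
    have h := hmin τ hτ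
    rw [relEnt_of_le hle, relEnt, if_neg hnot, top_le_iff] at h
    exact EReal.coe_ne_top _ h
  set σ := flatten σ₀ with hσdef
  have hσ : σ.PosSemidef := hσ₀p.submatrix _
  have hσt : tpow σ 1 = σ₀ := tpow_flatten σ₀
  have hle : msupp ρ ≤ msupp σ := msupp_flatten_le hσ₀p hle₀
  have hσS : ∀ n, 1 ≤ n → tpow σ n ∈ S n := fun n hn =>
    tpow_mem_of_tensOp_mem (fun n hn => hS.tens n 1 hn le_rfl) (hσt ▸ hσ₀) hn
  have hinf : ∀ n : ℕ, ((n : ℝ) : EReal) * ⨅ X ∈ S 1, relEnt (tpow ρ 1) X =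
      relEnt (tpow ρ n) (tpow σ n) := fun n => by
    have h1 : ⨅ X ∈ S 1, relEnt (tpow ρ 1) X = relEnt (tpow ρ 1) σ₀ :=
      le_antisymm (iInf₂_le σ₀ hσ₀) (le_iInf₂ hmin)
    rw [h1, ← hσt, relEnt_tpow hρ hσ hle, relEnt_tpow hρ hσ hle, ← EReal.coe_mul]
    simp
  have hadd : (∀ n : ℕ, 1 ≤ n → (⨅ X ∈ S n, relEnt (tpow ρ n) X) =
        ((n : ℝ) : EReal) * ⨅ X ∈ S 1, relEnt (tpow ρ 1) X) ↔
      ∀ n, 1 ≤ n → ∀ X ∈ S n, msupp (tpow ρ n) ≤ msupp X →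
        rtr (tpow ρ n * mlog X) ≤ rtr (tpow ρ n * mlog (tpow σ n)) := by
    refine forall_congr' fun n => forall_congr' fun hn => ?_
    rw [hinf n]
    constructor
    · intro h X hX hρX
      have h' := h.symm.le.trans (iInf₂_le X hX)
      rw [relEnt_of_le hρX, relEnt_of_le (msupp_tpow_le hσ hle n), EReal.coe_le_coe_iff] at h'
      linarith
    · intro h
      refine le_antisymm (iInf₂_le _ (hσS n hn)) (le_iInf₂ fun X hX => ?_)
      by_cases hρX : msupp (tpow ρ n) ≤ msupp X
      · rw [relEnt_of_le hρX, relEnt_of_le (msupp_tpow_le hσ hle n), EReal.coe_le_coe_iff]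
        linarith [h X hX hρX]
      · rw [relEnt, relEnt, if_neg hρX]
        exact le_top
  have hsup : (⨆ t : ℝ, ⨆ τ ∈ S 1, ((rtr (τ * rotated σ₀ (tpow ρ 1) t) : ℝ) : EReal)) = 1 ↔
      ∀ t : ℝ, ∀ τ ∈ S 1, rtr (τ * rotated σ₀ (tpow ρ 1) t) ≤ 1 := by
    constructor
    · intro h t τ hτ
      have h' := (le_iSup₂ (f := fun τ (_ : τ ∈ S 1) =>
        ((rtr (τ * rotated σ₀ (tpow ρ 1) t) : ℝ) : EReal)) τ hτ).trans
        ((le_iSup (fun t => ⨆ τ ∈ S 1, ((rtr (τ * rotated σ₀ (tpow ρ 1) t) : ℝ) : EReal)) t).trans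
          h.le)
      exact_mod_cast h'
    · intro h
      refine le_antisymm (iSup_le fun t => iSup₂_le fun τ hτ => by exact_mod_cast h t τ hτ) ?_
      refine le_iSup_of_le 0 (le_iSup₂_of_le σ₀ hσ₀ ?_)
      rw [rtr_self_mul_rotated hσ₀p hρ1.1.1 hle₀, hρ1.rtr_eq, EReal.coe_one]
  rw [hadd]
  refine Iff.trans ?_ hsup.symm
  constructor
  · intro hmax t τ hτ
    have hτp : (flatten τ).PosSemidef := (hS.psd 1 le_rfl τ hτ).submatrix _
    have h := rtr_mul_rotated_le_one hS hρ hσ hτp (hσS 1 le_rfl) ((tpow_flatten τ).symm ▸ hτ) hle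
      hmax t
    rw [← tpow_flatten τ, ← hσt, rtr_tpow_mul_rotated_tpow hσ hρ.1 hτp, pow_one]
    exact h
  · intro h n hn X hX hρX
    refine rtr_mul_mlog_le_of_rotated_mem_polar hS hρ hσ hle (fun t => ?_) hn hX hρX
    rw [← rotated_tpow hσ, hσt]
    refine ⟨posSemidef_rotated hσ₀p hρ1.1 t, fun Y hY => ?_⟩
    rw [rtr, Matrix.trace_mul_comm, ← rtr]
    exact h t Y hY

end QHT
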